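/- arXiv:1804.07679 — 3 statements merged into one kernel-verified Lean document; each statement's English description precedes it below -/
import Mathlib

section
/- For every q ∈ (1,2) and every ε > 0 there is a constant C_{q,ε} > 0 independent of the dimension d ∈ ℕ such that for every f ∈ ℓ^q(ℤ^d) one has ‖ ( Σ_{j=1}^d |𝓡_j f|² + |𝓡_j^* f|² )^{1/2} ‖_{ℓ^q(ℤ^d)} ≤ C_{q,ε} · d^{1/q − 1/2 + ε} · ‖f‖_{ℓ^q(ℤ^d)}. -/
open MeasureTheory ENNReal

/-- The ℓ^p(ℤ^d) "norm" of a nonnegative (ℝ≥0∞-valued) function, for finite `p`. -/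
noncomputable def lpZfin (d : ℕ) (p : ℝ) (g : (Fin d → ℤ) → ℝ≥0∞) : ℝ≥0∞ :=
  (∑' x, g x ^ p) ^ (1 / p)

/-- `|ξ|_sin = (Σ_k sin²(πξ_k))^{1/2}`. -/
noncomputable def sinNorm (d : ℕ) (ξ : Fin d → ℝ) : ℝ :=
  Real.sqrt (∑ k, Real.sin (Real.pi * ξ k) ^ 2)

/-- The Fourier multiplier operator on ℤ^d with symbol `m` on `𝕋^d ≡ [-1/2,1/2)^d`,
realized as convolution with the inverse Fourier transform of `m`. -/
noncomputable def fmOp (d : ℕ) (m : (Fin d → ℝ) → ℂ)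
    (f : (Fin d → ℤ) → ℂ) (x : Fin d → ℤ) : ℂ :=
  ∑' y : Fin d → ℤ,
    (∫ ξ in Set.Icc (fun _ => -(1 / 2 : ℝ)) (fun _ => (1 / 2 : ℝ)),
      m ξ * Complex.exp (-(2 * Real.pi * Complex.I) * ∑ k, (((x - y) k : ℤ) : ℂ) * (ξ k : ℂ)))
      * f y

/-- The symbol of the discrete Riesz transform `𝓡_j = (1/2)Δ_j 𝓛^{-1/2}`. -/
noncomputable def rieszSym (d : ℕ) (j : Fin d) (ξ : Fin d → ℝ) : ℂ :=
  (1 - Complex.exp (-(2 * Real.pi * Complex.I) * (ξ j : ℂ))) / (2 * (sinNorm d ξ : ℂ))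

/-- The symbol of the adjoint Riesz transform `𝓡_j^* = (1/2)Δ_j^* 𝓛^{-1/2}`. -/
noncomputable def rieszStarSym (d : ℕ) (j : Fin d) (ξ : Fin d → ℝ) : ℂ :=
  (1 - Complex.exp ((2 * Real.pi * Complex.I) * (ξ j : ℂ))) / (2 * (sinNorm d ξ : ℂ))

open ComplexConjugate

theorem deriv_nonpos_of_bdd (b b1 b2 : ℝ → ℝ) (h1 : ∀ t, HasDerivAt b (b1 t) t)
    (h2 : ∀ t, HasDerivAt b1 (b2 t) t) (hpos : ∀ t, 0 ≤ t → 0 ≤ b2 t) (C : ℝ)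
    (hC : ∀ t, 0 ≤ t → b t ≤ C) (t : ℝ) (ht : 0 ≤ t) : b1 t ≤ 0 := by
  by_contra hcon
  push Not at hcon
  have mono : MonotoneOn b1 (Set.Ici 0) := by
    apply monotoneOn_of_deriv_nonneg (convex_Ici 0)
    · exact fun x _ => (h2 x).continuousAt.continuousWithinAt
    · exact fun x _ => (h2 x).differentiableAt.differentiableWithinAt
    · intro x hx
      rw [(h2 x).deriv]
      simp at hx
      exact hpos x hx.le
  have key : MonotoneOn (fun s => b s - b1 t * s) (Set.Ici t) := by
    have hd : ∀ x, HasDerivAt (fun s => b s - b1 t * s) (b1 x - b1 t) x := by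
      intro x
      have h := (h1 x).fun_sub ((hasDerivAt_id' x).const_mul (b1 t))
      rwa [mul_one] at h
    apply monotoneOn_of_deriv_nonneg (convex_Ici t)
    · exact fun x _ => (hd x).continuousAt.continuousWithinAt
    · exact fun x _ => (hd x).differentiableAt.differentiableWithinAt
    · intro x hx
      rw [(hd x).deriv]
      simp at hx
      have := mono (Set.mem_Ici.2 ht) (Set.mem_Ici.2 (ht.trans hx.le)) hx.le
      linarith
  have h3 : 0 ≤ (|C - b t| + 1) / b1 t := by positivity
  have := key (Set.mem_Ici.2 le_rfl) (Set.mem_Ici.2 (by linarith : t ≤ t + (|C - b t| + 1) / b1 t))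
    (by linarith)
  have h4 := hC (t + (|C - b t| + 1) / b1 t) (by linarith)
  have h5 : b1 t * (t + (|C - b t| + 1) / b1 t) = b1 t * t + (|C - b t| + 1) := by
    field_simp
  simp only [h5] at this
  linarith [le_abs_self (C - b t)]

theorem flow {G ι K E : Type*} [Fintype G] [AddCommGroup G] [Fintype ι] [Fintype K]
    [NormedAddCommGroup E] [NormedSpace ℝ E] [ProperSpace E] (e : ι → G) (c : K → G → E)
    (ω : K → ℝ) (hω : ∀ k, 0 ≤ ω k)
    (hL : ∀ k x, (ω k) ^ 2 • c k x
      = (1 / 4 : ℝ) • ∑ j, ((c k x - c k (x + e j)) + (c k x - c k (x - e j))))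
    (B : E → ℝ) (hB : ContDiff ℝ 2 B) (hB0 : ∀ w, 0 ≤ B w)
    (H : E → E → ℝ) (hH0 : ∀ w h, 0 ≤ H w h)
    (hH : ∀ w h, H w h ≤ fderiv ℝ (fderiv ℝ B) w h h)
    (r : E → E → ℝ) (hr0 : ∀ w h, 0 ≤ r w h)
    (hr : ∀ a b, B a - B b + r a b ≤ fderiv ℝ B a (a - b)) :
    ∃ U U' : ℝ → ℝ, (∀ t, HasDerivAt U (U' t) t) ∧
      (∀ t, 0 ≤ t → t * ∑ x, (H (∑ k, Real.exp (-(t * ω k)) • c k x)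
          (∑ k, (-ω k * Real.exp (-(t * ω k))) • c k x)
          + 1 / 4 * ∑ j, r (∑ k, Real.exp (-(t * ω k)) • c k x)
            (∑ k, Real.exp (-(t * ω k)) • c k (x + e j))) ≤ U' t) ∧
      (∀ t, 0 ≤ t → U t ≤ 0) ∧
      U 0 = - ∑ x, B (∑ k, c k x) := by
  set w : ℝ → G → E := fun t x => ∑ k, Real.exp (-(t * ω k)) • c k x with hw
  set w1 : ℝ → G → E := fun t x => ∑ k, (-ω k * Real.exp (-(t * ω k))) • c k x with hw1
  set w2 : ℝ → G → E := fun t x => ∑ k, (ω k ^ 2 * Real.exp (-(t * ω k))) • c k x with hw2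
  have hexp : ∀ k t, HasDerivAt (fun t => Real.exp (-(t * ω k)))
      (-ω k * Real.exp (-(t * ω k))) t := by
    intro k t
    have h0 : HasDerivAt (fun t => -(t * ω k)) (-ω k) t := (hasDerivAt_mul_const (ω k)).fun_neg
    have := h0.exp
    rwa [mul_comm] at this
  have dw : ∀ t x, HasDerivAt (fun t => w t x) (w1 t x) t := by
    intro t x
    exact HasDerivAt.fun_sum fun k _ => (hexp k t).smul_const (c k x)
  have dw1 : ∀ t x, HasDerivAt (fun t => w1 t x) (w2 t x) t := by
    intro t x
    refine HasDerivAt.fun_sum fun k _ => ?_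
    convert ((hexp k t).const_mul (-ω k)).smul_const (c k x) using 2
    ring
  have w2eq : ∀ t x, w2 t x
      = (1 / 4 : ℝ) • ∑ j, ((w t x - w t (x + e j)) + (w t x - w t (x - e j))) := by
    intro t x
    simp only [hw2, hw, ← Finset.sum_sub_distrib, ← Finset.sum_add_distrib]
    rw [Finset.sum_comm, Finset.smul_sum]
    refine Finset.sum_congr rfl fun k _ => ?_
    rw [mul_comm, mul_smul, hL, smul_comm, Finset.smul_sum]
    simp only [smul_sub, smul_add]
  have hB1 : ContDiff ℝ 1 (fderiv ℝ B) := hB.fderiv_right (by norm_num)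
  have dB : ∀ a, HasFDerivAt B (fderiv ℝ B a) a := fun a =>
    (hB.differentiable (by norm_num) a).hasFDerivAt
  have dB1 : ∀ a, HasFDerivAt (fderiv ℝ B) (fderiv ℝ (fderiv ℝ B) a) a := fun a =>
    (hB1.differentiable (by norm_num) a).hasFDerivAt
  set b : ℝ → ℝ := fun t => ∑ x, B (w t x) with hb
  set b1 : ℝ → ℝ := fun t => ∑ x, fderiv ℝ B (w t x) (w1 t x) with hb1
  set b2 : ℝ → ℝ := fun t => ∑ x, (fderiv ℝ (fderiv ℝ B) (w t x) (w1 t x) (w1 t x)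
    + fderiv ℝ B (w t x) (w2 t x)) with hb2
  have db : ∀ t, HasDerivAt b (b1 t) t := by
    intro t
    exact HasDerivAt.fun_sum fun x _ => (dB (w t x)).comp_hasDerivAt (f := fun t => w t x) t (dw t x)
  have db1 : ∀ t, HasDerivAt b1 (b2 t) t := by
    intro t
    refine HasDerivAt.fun_sum fun x _ => ?_
    have h1 : HasDerivAt (fun t => fderiv ℝ B (w t x))
      (fderiv ℝ (fderiv ℝ B) (w t x) (w1 t x)) t :=
      (dB1 (w t x)).comp_hasDerivAt (f := fun t => w t x) t (dw t x)
    exact h1.clm_apply (dw1 t x)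
  have low : ∀ t, ∑ x, (H (w t x) (w1 t x) + 1 / 4 * ∑ j, r (w t x) (w t (x + e j))) ≤ b2 t := by
    intro t
    simp only [hb2, Finset.sum_add_distrib]
    refine add_le_add (Finset.sum_le_sum fun x _ => hH _ _) ?_
    have h1 : ∀ x, 1 / 4 * ∑ j, ((B (w t x) - B (w t (x + e j)) + r (w t x) (w t (x + e j)))
        + (B (w t x) - B (w t (x - e j)))) ≤ fderiv ℝ B (w t x) (w2 t x) := by
      intro x
      rw [w2eq, map_smul, map_sum, smul_eq_mul]
      gcongr with j
      rw [map_add]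
      gcongr
      · exact hr _ _
      · have := hr (w t x) (w t (x - e j))
        linarith [hr0 (w t x) (w t (x - e j))]
    refine le_trans (le_of_eq ?_) (Finset.sum_le_sum fun x _ => h1 x)
    simp only [← Finset.mul_sum]
    congr 1
    rw [Finset.sum_comm]
    conv_rhs => rw [Finset.sum_comm]
    refine Finset.sum_congr rfl fun j _ => ?_
    simp only [Finset.sum_add_distrib, Finset.sum_sub_distrib]
    have e1 : ∑ x, B (w t (x + e j)) = ∑ x, B (w t x) :=
      Equiv.sum_comp (Equiv.addRight (e j)) (fun x => B (w t x))
    have e2 : ∑ x, B (w t (x - e j)) = ∑ x, B (w t x) :=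
      Equiv.sum_comp (Equiv.subRight (e j)) (fun x => B (w t x))
    rw [e1, e2]; ring
  have lowpos : ∀ t, 0 ≤ ∑ x, (H (w t x) (w1 t x) + 1 / 4 * ∑ j, r (w t x) (w t (x + e j))) := by
    intro t
    refine Finset.sum_nonneg fun x _ => add_nonneg (hH0 _ _) ?_
    exact mul_nonneg (by norm_num) (Finset.sum_nonneg fun j _ => hr0 _ _)
  have bdd : ∃ C, ∀ t, 0 ≤ t → b t ≤ C := by
    have : ∀ x, ∃ C, ∀ t, 0 ≤ t → B (w t x) ≤ C := by
      intro x
      obtain ⟨C, hC⟩ := (isCompact_closedBall (0 : E) (∑ k, ‖c k x‖)).bddAbove_image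
        hB.continuous.continuousOn
      refine ⟨C, fun t ht => hC ⟨w t x, ?_, rfl⟩⟩
      rw [mem_closedBall_zero_iff]
      refine (norm_sum_le _ _).trans (Finset.sum_le_sum fun k _ => ?_)
      rw [norm_smul, Real.norm_of_nonneg (Real.exp_pos _).le]
      refine mul_le_of_le_one_left (norm_nonneg _) (Real.exp_le_one_iff.2 ?_)
      have := mul_nonneg ht (hω k)
      linarith
    choose C hC using this
    exact ⟨∑ x, C x, fun t ht => Finset.sum_le_sum fun x _ => hC x t ht⟩
  obtain ⟨C, hC⟩ := bdd
  refine ⟨fun t => t * b1 t - b t, fun t => t * b2 t, ?_, ?_, ?_, ?_⟩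
  · intro t
    have h := ((hasDerivAt_id' t).fun_mul (db1 t)).fun_sub (db t)
    have h2 : 1 * b1 t + t * b2 t - b1 t = t * b2 t := by ring
    rwa [h2] at h
  · intro t ht
    exact mul_le_mul_of_nonneg_left (low t) ht
  · intro t ht
    have h1 := deriv_nonpos_of_bdd b b1 b2 db db1
      (fun t ht => (lowpos t).trans (low t)) C hC t ht
    have h2 : 0 ≤ b t := Finset.sum_nonneg fun x _ => hB0 _
    show t * b1 t - b t ≤ 0
    nlinarith
  · simp [hb, hw]

theorem hess_line {E : Type*} [NormedAddCommGroup E] [NormedSpace ℝ E]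
    (B : E → ℝ) (hB : ContDiff ℝ 2 B) (w h : E) (g1 : ℝ → ℝ) (g2 : ℝ)
    (h1 : ∀ t : ℝ, HasDerivAt (fun t : ℝ => B (w + t • h)) (g1 t) t) (h2 : HasDerivAt g1 g2 0) :
    fderiv ℝ (fderiv ℝ B) w h h = g2 := by
  have hB1 : ContDiff ℝ 1 (fderiv ℝ B) := hB.fderiv_right (by norm_num)
  have dl : ∀ t : ℝ, HasDerivAt (fun t : ℝ => w + t • h) h t := by
    intro t
    simpa using ((hasDerivAt_id' t).smul_const h).const_add w
  have e1 : g1 = fun t : ℝ => fderiv ℝ B (w + t • h) h := by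
    funext t
    refine (h1 t).unique ?_
    exact (hB.differentiable (by norm_num) (w + t • h)).hasFDerivAt.comp_hasDerivAt
      (f := fun t : ℝ => w + t • h) t (dl t)
  rw [e1] at h2
  have h3 : HasDerivAt (fun t : ℝ => fderiv ℝ B (w + t • h))
      (fderiv ℝ (fderiv ℝ B) (w + (0 : ℝ) • h) h) 0 :=
    (hB1.differentiable (by norm_num) (w + (0 : ℝ) • h)).hasFDerivAt.comp_hasDerivAt
      (f := fun t : ℝ => w + t • h) 0 (dl 0)
  have h4 := h3.clm_apply (hasDerivAt_const (0 : ℝ) h)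
  have := h4.unique h2
  simpa using this

theorem taylor_low {E : Type*} [NormedAddCommGroup E] [NormedSpace ℝ E]
    (B : E → ℝ) (hB : ContDiff ℝ 2 B) (a b : E) (m : ℝ)
    (hm : ∀ s : ℝ, 0 ≤ s → s ≤ 1 →
      m ≤ fderiv ℝ (fderiv ℝ B) (a + s • (b - a)) (b - a) (b - a)) :
    B a - B b + m / 2 ≤ fderiv ℝ B a (a - b) := by
  have hB1 : ContDiff ℝ 1 (fderiv ℝ B) := hB.fderiv_right (by norm_num)
  set h := b - a with hh
  have dl : ∀ t : ℝ, HasDerivAt (fun t : ℝ => a + t • h) h t := by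
    intro t
    simpa using ((hasDerivAt_id' t).smul_const h).const_add a
  have d1 : ∀ t : ℝ, HasDerivAt (fun t : ℝ => B (a + t • h)) (fderiv ℝ B (a + t • h) h) t :=
    fun t => (hB.differentiable (by norm_num) (a + t • h)).hasFDerivAt.comp_hasDerivAt
      (f := fun t : ℝ => a + t • h) t (dl t)
  have d2 : ∀ t : ℝ, HasDerivAt (fun t : ℝ => fderiv ℝ B (a + t • h) h)
      (fderiv ℝ (fderiv ℝ B) (a + t • h) h h) t := by
    intro t
    have h3 : HasDerivAt (fun t : ℝ => fderiv ℝ B (a + t • h))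
        (fderiv ℝ (fderiv ℝ B) (a + t • h) h) t :=
      (hB1.differentiable (by norm_num) (a + t • h)).hasFDerivAt.comp_hasDerivAt
        (f := fun t : ℝ => a + t • h) t (dl t)
    simpa using h3.clm_apply (hasDerivAt_const t h)
  have mono1 : MonotoneOn (fun t : ℝ => fderiv ℝ B (a + t • h) h - m * t) (Set.Icc 0 1) := by
    have hd : ∀ x, HasDerivAt (fun t : ℝ => fderiv ℝ B (a + t • h) h - m * t)
        (fderiv ℝ (fderiv ℝ B) (a + x • h) h h - m * 1) x := fun x =>
      (d2 x).fun_sub ((hasDerivAt_id' x).const_mul m)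
    apply monotoneOn_of_deriv_nonneg (convex_Icc 0 1)
    · exact fun x _ => (hd x).continuousAt.continuousWithinAt
    · exact fun x _ => (hd x).differentiableAt.differentiableWithinAt
    · intro x hx
      rw [(hd x).deriv]
      simp at hx
      linarith [hm x hx.1.le hx.2.le]
  have mono2 : MonotoneOn (fun t : ℝ => B (a + t • h) - (fderiv ℝ B a h * t + m / 2 * t ^ 2))
      (Set.Icc 0 1) := by
    have hd : ∀ x, HasDerivAt (fun t : ℝ => B (a + t • h) - (fderiv ℝ B a h * t + m / 2 * t ^ 2))
        (fderiv ℝ B (a + x • h) h - (fderiv ℝ B a h * 1 + m / 2 * (2 * x ))) x := fun x => by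
      refine (d1 x).fun_sub (((hasDerivAt_id' x).const_mul _).fun_add (HasDerivAt.const_mul _ ?_))
      simpa using hasDerivAt_pow 2 x
    apply monotoneOn_of_deriv_nonneg (convex_Icc 0 1)
    · exact fun x _ => (hd x).continuousAt.continuousWithinAt
    · exact fun x _ => (hd x).differentiableAt.differentiableWithinAt
    · intro x hx
      rw [(hd x).deriv]
      simp at hx
      have := mono1 (Set.mem_Icc.2 ⟨le_rfl, zero_le_one⟩) (Set.mem_Icc.2 ⟨hx.1.le, hx.2.le⟩) hx.1.le
      simp at this
      linarith
  have := mono2 (Set.mem_Icc.2 ⟨le_rfl, zero_le_one⟩) (Set.mem_Icc.2 ⟨zero_le_one, le_rfl⟩)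
    zero_le_one
  simp [hh] at this
  have e : fderiv ℝ B a (a - b) = - (fderiv ℝ B a b - fderiv ℝ B a a) := by
    rw [map_sub]; ring
  rw [e]
  linarith

theorem pow_hess (ρ α α1 α2 : ℝ) (hρ : 1 / 2 < ρ) (hα : 0 < α) (h1 : α1 ^ 2 ≤ 2 * α * α2) (h2 : 0 ≤ α2)
    (κ : ℝ) (hκ : 0 < κ) (hκ1 : κ ≤ 1) (hκ2 : κ ≤ 2 * ρ - 1) :
    ρ * κ * (α ^ (ρ - 1) * α2) ≤ ρ * α ^ (ρ - 1) * α2 + ρ * (ρ - 1) * α ^ (ρ - 2) * α1 ^ 2 ∧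
    (ρ * α ^ (ρ - 1) * α1) ^ 2 ≤ (2 * ρ / κ) * (α ^ ρ *
      (ρ * α ^ (ρ - 1) * α2 + ρ * (ρ - 1) * α ^ (ρ - 2) * α1 ^ 2)) := by
  have e1 : α ^ (ρ - 1) = α ^ (ρ - 2) * α := by
    rw [← Real.rpow_add_one hα.ne']; congr 1; ring
  have e2 : α ^ ρ = α ^ (ρ - 1) * α := by
    rw [← Real.rpow_add_one hα.ne']; congr 1; ring
  have hY : 0 < α ^ (ρ - 2) := Real.rpow_pos_of_pos hα _
  have hX : 0 < α ^ (ρ - 1) := Real.rpow_pos_of_pos hα _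
  have hS : 0 < α ^ (ρ) := Real.rpow_pos_of_pos hα _
  have hYa : α ^ (ρ - 2) * α1 ^ 2 ≤ 2 * (α ^ (ρ - 1) * α2) := by
    rw [e1]; nlinarith
  have hYa0 : 0 ≤ α ^ (ρ - 2) * α1 ^ 2 := by positivity
  have hXa0 : 0 ≤ α ^ (ρ - 1) * α2 := by positivity
  have first : ρ * κ * (α ^ (ρ - 1) * α2) ≤ ρ * α ^ (ρ - 1) * α2
      + ρ * (ρ - 1) * α ^ (ρ - 2) * α1 ^ 2 := by
    have : κ * (α ^ (ρ - 1) * α2) ≤ α ^ (ρ - 1) * α2 + (ρ - 1) * (α ^ (ρ - 2) * α1 ^ 2) := by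
      rcases le_total 1 ρ with h | h
      · nlinarith [mul_nonneg (sub_nonneg.2 h) hYa0]
      · nlinarith [mul_nonneg (sub_nonneg.2 h) (sub_nonneg.2 hYa)]
    have := mul_le_mul_of_nonneg_left this (by linarith : 0 ≤ ρ)
    linarith
  refine ⟨first, ?_⟩
  calc (ρ * α ^ (ρ - 1) * α1) ^ 2 = ρ ^ 2 * (α ^ (ρ - 1)) ^ 2 * α1 ^ 2 := by ring
    _ ≤ ρ ^ 2 * (α ^ (ρ - 1)) ^ 2 * (2 * α * α2) := by gcongr
    _ = (2 * ρ / κ) * (α ^ ρ * (ρ * κ * (α ^ (ρ - 1) * α2))) := by rw [e2]; field_simp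
    _ ≤ _ := by
      have : 0 < ρ := by linarith
      gcongr

/-- scalar Bellman inequality -/
theorem bell_scalar (K p θ s s1 s2 r r1 r2 ζ ζ1 ζ2 : ℝ) (hp : 0 ≤ p) (hK : K = 5 * p)
    (hθ0 : 0 ≤ θ) (hθ1 : θ ≤ 1)
    (hs : 0 < s) (hr : 0 < r) (hs2 : 0 ≤ s2) (hr2 : 0 ≤ r2) (hζ : 0 < ζ) (hζ2 : 0 ≤ ζ2)
    (h1 : s1 ^ 2 ≤ p * (s * s2)) (h2 : r1 ^ 2 ≤ p * (r * r2)) (h3 : ζ1 ^ 2 ≤ 2 * ζ * ζ2)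
    (h4 : ζ ≤ (s + r) ^ (1 - θ)) :
    (1 / 2) * ζ2 * s ^ θ ≤ K * (s2 + r2) + ζ2 * (s + r) ^ θ + 2 * ζ1 * (θ * (s + r) ^ (θ - 1) * (s1 + r1))
      + ζ * (θ * (s + r) ^ (θ - 1) * (s2 + r2) + θ * (θ - 1) * (s + r) ^ (θ - 2) * (s1 + r1) ^ 2) := by
  set M := s + r with hM
  have hMp : 0 < M := by positivity
  set M1 := s1 + r1 with hM1
  set M2 := s2 + r2 with hM2
  have hM20 : 0 ≤ M2 := by positivity
  have hMM : M1 ^ 2 ≤ p * (M * M2) := by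
    have hcross : 2 * (s1 * r1) ≤ p * (s * r2 + r * s2) := by
      have a1 : (s1 * r1) ^ 2 ≤ (p * (s * s2)) * (p * (r * r2)) := by
        rw [mul_pow]; gcongr
      have a2 : (2 * (s1 * r1)) ^ 2 ≤ (p * (s * r2 + r * s2)) ^ 2 := by
        nlinarith [sq_nonneg (p * (s * r2 - r * s2))]
      exact le_of_sq_le_sq a2 (by positivity)
    simp only [hM1, hM, hM2]
    nlinarith
  set T := M ^ θ with hT
  have hTp : 0 < T := Real.rpow_pos_of_pos hMp _
  have e1 : M ^ (θ - 1) = T / M := by rw [Real.rpow_sub_one hMp.ne']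
  have e2 : M ^ (θ - 2) = T / M ^ 2 := by
    rw [Real.rpow_sub hMp]; norm_num [hT]
  have hζT : ζ * T ≤ M := by
    calc ζ * T ≤ M ^ (1 - θ) * M ^ θ := by gcongr
      _ = M := by rw [← Real.rpow_add hMp]; simp
  have hsT : s ^ θ ≤ T := Real.rpow_le_rpow hs.le (by linarith) hθ0
  rw [e1, e2]
  -- D = M1^2/M
  have hD : M1 ^ 2 / M ≤ p * M2 := by
    rw [div_le_iff₀ hMp]; linarith
  have hD0 : 0 ≤ M1 ^ 2 / M := by positivity
  have hζD : ζ * T * M1 ^ 2 / M ^ 2 ≤ M1 ^ 2 / M := by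
    rw [div_le_div_iff₀ (by positivity) hMp]
    nlinarith [mul_nonneg (mul_nonneg (sq_nonneg M1) hMp.le) (sub_nonneg.2 hζT)]
  have hcr : - (1 / 2 * ζ2 * T + 4 * (ζ * T * M1 ^ 2 / M ^ 2)) ≤ 2 * ζ1 * (θ * (T / M) * M1) := by
    have b1 : ζ1 ^ 2 / ζ ≤ 2 * ζ2 := by
      rw [div_le_iff₀ hζ]; linarith
    have b2 : 0 ≤ T * (1 / 4 * (ζ1 ^ 2 / ζ) + 2 * ζ1 * θ * M1 / M + 4 * θ ^ 2 * ζ * M1 ^ 2 / M ^ 2) := by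
      have : 1 / 4 * (ζ1 ^ 2 / ζ) + 2 * ζ1 * θ * M1 / M + 4 * θ ^ 2 * ζ * M1 ^ 2 / M ^ 2
        = (1 / ζ) * (ζ1 / 2 + 2 * θ * ζ * M1 / M) ^ 2 := by
        field_simp; ring
      rw [this]; positivity
    have b3 : θ ^ 2 * (ζ * T * M1 ^ 2 / M ^ 2) ≤ 1 * (ζ * T * M1 ^ 2 / M ^ 2) := by
      gcongr; nlinarith
    have b4 : T * (1 / 4 * (ζ1 ^ 2 / ζ)) ≤ T * (1 / 4 * (2 * ζ2)) := by gcongr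
    have b5 : T * (1 / 4 * (ζ1 ^ 2 / ζ) + 2 * ζ1 * θ * M1 / M + 4 * θ ^ 2 * ζ * M1 ^ 2 / M ^ 2)
      = T * (1 / 4 * (ζ1 ^ 2 / ζ)) + 2 * ζ1 * (θ * (T / M) * M1)
        + 4 * (θ ^ 2 * (ζ * T * M1 ^ 2 / M ^ 2)) := by ring
    rw [b5] at b2
    linarith
  have hl : - (ζ * T * M1 ^ 2 / M ^ 2) ≤ ζ * (θ * (T / M) * M2 + θ * (θ - 1) * (T / M ^ 2) * M1 ^ 2) := by
    have c1 : 0 ≤ ζ * (θ * (T / M) * M2) := by positivity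
    have c2 : θ * (1 - θ) * (ζ * T * M1 ^ 2 / M ^ 2) ≤ 1 * (ζ * T * M1 ^ 2 / M ^ 2) := by
      gcongr; nlinarith
    have c3 : ζ * (θ * (T / M) * M2 + θ * (θ - 1) * (T / M ^ 2) * M1 ^ 2)
      = ζ * (θ * (T / M) * M2) - θ * (1 - θ) * (ζ * T * M1 ^ 2 / M ^ 2) := by ring
    rw [c3]; linarith
  have hz : 1 / 2 * ζ2 * s ^ θ ≤ 1 / 2 * ζ2 * T := by gcongr
  rw [hK]
  linarith

theorem al_pos {E : Type*} [NormedAddCommGroup E] (η : ℝ) (hη : 0 < η) (u : E) :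
    0 < ‖u‖ ^ 2 + η ^ 2 := by positivity

theorem al_contDiff {E : Type*} [NormedAddCommGroup E] [InnerProductSpace ℝ E] (η : ℝ) :
    ContDiff ℝ 2 (fun u : E => ‖u‖ ^ 2 + η ^ 2) :=
  (contDiff_norm_sq ℝ).add contDiff_const

theorem al_line {E : Type*} [NormedAddCommGroup E] [InnerProductSpace ℝ E] (η : ℝ) (w h : E) (t : ℝ) :
    HasDerivAt (fun t : ℝ => ‖w + t • h‖ ^ 2 + η ^ 2) (2 * inner ℝ (w + t • h) h) t := by
  have dl : HasDerivAt (fun t : ℝ => w + t • h) h t := by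
    simpa using ((hasDerivAt_id' t).smul_const h).const_add w
  exact dl.norm_sq.add_const _

theorem al_line2 {E : Type*} [NormedAddCommGroup E] [InnerProductSpace ℝ E] (w h : E) (t : ℝ) :
    HasDerivAt (fun t : ℝ => 2 * inner ℝ (w + t • h) h) (2 * ‖h‖ ^ 2) t := by
  have dl : HasDerivAt (fun t : ℝ => w + t • h) h t := by
    simpa using ((hasDerivAt_id' t).smul_const h).const_add w
  have := (dl.inner ℝ (hasDerivAt_const t h)).const_mul 2
  simpa using this

theorem al_cs {E : Type*} [NormedAddCommGroup E] [InnerProductSpace ℝ E] (η : ℝ) (w h : E) :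
    (2 * inner ℝ w h) ^ 2 ≤ 2 * (‖w‖ ^ 2 + η ^ 2) * (2 * ‖h‖ ^ 2) := by
  have h1 := abs_real_inner_le_norm w h
  have h2 : (inner ℝ w h) ^ 2 ≤ (‖w‖ * ‖h‖) ^ 2 := sq_le_sq.2 (by
    rwa [abs_of_nonneg (by positivity : 0 ≤ ‖w‖ * ‖h‖)])
  nlinarith [mul_nonneg (sq_nonneg η) (sq_nonneg ‖h‖)]

/-- derivatives of a power of a positive function -/
theorem pow_line (ρ : ℝ) (α α1 : ℝ → ℝ) (α2 : ℝ) (hα : ∀ t, 0 < α t)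
    (h1 : ∀ t, HasDerivAt α (α1 t) t) (h2 : HasDerivAt α1 α2 0) :
    (∀ t, HasDerivAt (fun t => α t ^ ρ) (ρ * α t ^ (ρ - 1) * α1 t) t) ∧
    HasDerivAt (fun t => ρ * α t ^ (ρ - 1) * α1 t)
      (ρ * α 0 ^ (ρ - 1) * α2 + ρ * (ρ - 1) * α 0 ^ (ρ - 2) * α1 0 ^ 2) 0 := by
  have h : ∀ ρ t, HasDerivAt (fun t => α t ^ ρ) (ρ * α t ^ (ρ - 1) * α1 t) t := by
    intro ρ t
    have := (h1 t).rpow_const (p := ρ) (Or.inl (hα t).ne')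
    convert this using 1; ring
  refine ⟨h ρ, ?_⟩
  have := ((h (ρ - 1) 0).const_mul ρ).fun_mul h2
  refine this.congr_deriv ?_
  rw [show ρ - 1 - 1 = ρ - 2 by ring]; ring

theorem phi_hess {E : Type*} [NormedAddCommGroup E] [InnerProductSpace ℝ E] (q η : ℝ)
    (hq1 : 1 < q) (hq2 : q < 2) (hη : 0 < η) (w h : E) :
    ContDiff ℝ 2 (fun u : E => (‖u‖ ^ 2 + η ^ 2) ^ (q / 2)) ∧
    q * (q - 1) * (‖w‖ ^ 2 + η ^ 2) ^ (q / 2 - 1) * ‖h‖ ^ 2 ≤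
      fderiv ℝ (fderiv ℝ (fun u : E => (‖u‖ ^ 2 + η ^ 2) ^ (q / 2))) w h h := by
  have hC : ContDiff ℝ 2 (fun u : E => (‖u‖ ^ 2 + η ^ 2) ^ (q / 2)) :=
    (al_contDiff η).rpow_const_of_ne fun u => (al_pos η hη u).ne'
  refine ⟨hC, ?_⟩
  obtain ⟨p1, p2⟩ := pow_line (q / 2) (fun t => ‖w + t • h‖ ^ 2 + η ^ 2)
    (fun t => 2 * inner ℝ (w + t • h) h) (2 * ‖h‖ ^ 2) (fun t => al_pos η hη _)
    (al_line η w h) (al_line2 w h 0)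
  rw [hess_line _ hC w h _ _ p1 p2]
  simp only [zero_smul, add_zero]
  have := (pow_hess (q / 2) (‖w‖ ^ 2 + η ^ 2) (2 * inner ℝ w h) (2 * ‖h‖ ^ 2) (by linarith)
    (al_pos η hη w) (al_cs η w h) (by positivity) (q - 1) (by linarith) (by linarith)
    (by linarith)).1
  refine le_trans (le_of_eq ?_) this
  ring

theorem phi_low {E : Type*} [NormedAddCommGroup E] [InnerProductSpace ℝ E] (q η : ℝ)
    (hq1 : 1 < q) (hq2 : q < 2) (hη : 0 < η) (a b : E) :
    (‖a‖ ^ 2 + η ^ 2) ^ (q / 2) - (‖b‖ ^ 2 + η ^ 2) ^ (q / 2)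
      + (q * (q - 1) / 2) * ((max ‖a‖ ‖b‖) ^ 2 + η ^ 2) ^ (q / 2 - 1) * ‖a - b‖ ^ 2
      ≤ fderiv ℝ (fun u : E => (‖u‖ ^ 2 + η ^ 2) ^ (q / 2)) a (a - b) := by
  have := taylor_low (fun u : E => (‖u‖ ^ 2 + η ^ 2) ^ (q / 2))
    (phi_hess q η hq1 hq2 hη a a).1 a b
    (q * (q - 1) * ((max ‖a‖ ‖b‖) ^ 2 + η ^ 2) ^ (q / 2 - 1) * ‖a - b‖ ^ 2) (by
      intro s hs0 hs1
      refine le_trans ?_ (phi_hess q η hq1 hq2 hη _ _).2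
      rw [norm_sub_rev]
      have hn : ‖a + s • (b - a)‖ ≤ max ‖a‖ ‖b‖ := by
        have : a + s • (b - a) = (1 - s) • a + s • b := by module
        rw [this]
        refine (norm_add_le _ _).trans ?_
        rw [norm_smul, norm_smul, Real.norm_of_nonneg hs0, Real.norm_of_nonneg (by linarith)]
        nlinarith [le_max_left ‖a‖ ‖b‖, le_max_right ‖a‖ ‖b‖]
      have : 0 ≤ q * (q - 1) := mul_nonneg (by linarith) (by linarith)
      have h2 : (max ‖a‖ ‖b‖ ^ 2 + η ^ 2) ^ (q / 2 - 1)
          ≤ (‖a + s • (b - a)‖ ^ 2 + η ^ 2) ^ (q / 2 - 1) := by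
        apply Real.rpow_le_rpow_of_nonpos (al_pos η hη _) _ (by linarith)
        gcongr
      gcongr)
  refine le_trans (le_of_eq ?_) this
  ring

/-- The Bellman function. -/
noncomputable def bell {E F : Type*} [NormedAddCommGroup E] [NormedAddCommGroup F]
    (q p η : ℝ) (z : E × F) : ℝ :=
  5 * p * ((‖z.1‖ ^ 2 + η ^ 2) ^ (q / 2) + (‖z.2‖ ^ 2 + η ^ 2) ^ (p / 2))
    + (‖z.2‖ ^ 2 + η ^ 2) *
      ((‖z.1‖ ^ 2 + η ^ 2) ^ (q / 2) + (‖z.2‖ ^ 2 + η ^ 2) ^ (p / 2)) ^ (2 / q - 1)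

theorem bell_zeta (q p s ζ : ℝ) (hq1 : 1 < q) (hq2 : q < 2) (hpq : p * (q - 1) = q)
    (hs : 0 < s) (hζ : 0 < ζ) : ζ ≤ (s + ζ ^ (p / 2)) ^ (1 - (2 / q - 1)) := by
  have hp : 0 < p := by
    by_contra h
    push Not at h
    nlinarith
  have : 1 - (2 / q - 1) = 2 / p := by
    have : q ≠ 0 := by linarith
    field_simp
    nlinarith
  rw [this]
  calc ζ = (ζ ^ (p / 2)) ^ (2 / p) := by
        rw [← Real.rpow_mul hζ.le]
        rw [show p / 2 * (2 / p) = 1 by field_simp]; simp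
    _ ≤ _ := by
      apply Real.rpow_le_rpow (by positivity) (by linarith) (by positivity)

theorem bell_bounds {E F : Type*} [NormedAddCommGroup E] [NormedAddCommGroup F]
    (q p η : ℝ) (hq1 : 1 < q) (hq2 : q < 2) (hpq : p * (q - 1) = q) (hη : 0 < η) (z : E × F) :
    0 ≤ bell q p η z ∧ bell q p η z ≤ (5 * p + 1) *
      ((‖z.1‖ ^ 2 + η ^ 2) ^ (q / 2) + (‖z.2‖ ^ 2 + η ^ 2) ^ (p / 2)) := by
  have hp : 0 < p := by
    by_contra h
    push Not at h
    nlinarith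
  have ha := al_pos η hη z.1
  have hz := al_pos η hη z.2
  unfold bell
  refine ⟨by positivity, ?_⟩
  have h1 := bell_zeta q p ((‖z.1‖ ^ 2 + η ^ 2) ^ (q / 2)) _ hq1 hq2 hpq (by positivity) hz
  set M := (‖z.1‖ ^ 2 + η ^ 2) ^ (q / 2) + (‖z.2‖ ^ 2 + η ^ 2) ^ (p / 2) with hM
  have hMp : 0 < M := by positivity
  have : (‖z.2‖ ^ 2 + η ^ 2) * M ^ (2 / q - 1) ≤ M := by
    calc (‖z.2‖ ^ 2 + η ^ 2) * M ^ (2 / q - 1) ≤ M ^ (1 - (2 / q - 1)) * M ^ (2 / q - 1) := by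
          gcongr
      _ = M := by rw [← Real.rpow_add hMp]; simp
  linarith

theorem bell_hess {E F : Type*} [NormedAddCommGroup E] [InnerProductSpace ℝ E]
    [NormedAddCommGroup F] [InnerProductSpace ℝ F] (q p η : ℝ)
    (hq1 : 1 < q) (hq2 : q < 2) (hpq : p * (q - 1) = q) (hη : 0 < η) (w h : E × F) :
    ContDiff ℝ 2 (bell q p η : E × F → ℝ) ∧
    (‖w.1‖ ^ 2 + η ^ 2) ^ (1 - q / 2) * ‖h.2‖ ^ 2 ≤
      fderiv ℝ (fderiv ℝ (bell q p η)) w h h := by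
  have hp : 2 < p := by
    by_contra h
    push Not at h
    nlinarith
  have cA : ContDiff ℝ 2 (fun z : E × F => ‖z.1‖ ^ 2 + η ^ 2) := (al_contDiff η).comp contDiff_fst
  have cZ : ContDiff ℝ 2 (fun z : E × F => ‖z.2‖ ^ 2 + η ^ 2) := (al_contDiff η).comp contDiff_snd
  have cM : ContDiff ℝ 2 (fun z : E × F => (‖z.1‖ ^ 2 + η ^ 2) ^ (q / 2)
      + (‖z.2‖ ^ 2 + η ^ 2) ^ (p / 2)) :=
    (cA.rpow_const_of_ne fun u => (al_pos η hη u.1).ne').add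
      (cZ.rpow_const_of_ne fun u => (al_pos η hη u.2).ne')
  have hMp : ∀ z : E × F, 0 < (‖z.1‖ ^ 2 + η ^ 2) ^ (q / 2) + (‖z.2‖ ^ 2 + η ^ 2) ^ (p / 2) := by
    intro z
    have ha := al_pos η hη z.1
    have hz := al_pos η hη z.2
    positivity
  have hC : ContDiff ℝ 2 (bell q p η : E × F → ℝ) :=
    (contDiff_const.mul cM).add (cZ.mul (cM.rpow_const_of_ne fun u => (hMp u).ne'))
  refine ⟨hC, ?_⟩
  have lA := al_line η w.1 h.1
  have lA2 := al_line2 w.1 h.1 0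
  have lZ := al_line η w.2 h.2
  have lZ2 := al_line2 w.2 h.2 0
  obtain ⟨s1, s2⟩ := pow_line (q / 2) _ _ _ (fun t => al_pos η hη _) lA lA2
  obtain ⟨r1, r2⟩ := pow_line (p / 2) _ _ _ (fun t => al_pos η hη _) lZ lZ2
  have m1 := fun t => (s1 t).fun_add (r1 t)
  have m2 := s2.fun_add r2
  obtain ⟨v1, v2⟩ := pow_line (2 / q - 1) _ _ _ (fun t => hMp (w + t • h)) m1 m2
  have b1 := fun t => ((m1 t).const_mul (5 * p)).fun_add ((lZ t).fun_mul (v1 t))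
  have b2 := (m2.const_mul (5 * p)).fun_add ((lZ2.fun_mul (v1 0)).fun_add ((lZ 0).fun_mul v2))
  rw [hess_line _ hC w h _ _ b1 b2]
  clear b1 b2 v1 v2 m1 m2 r1 r2 s1 s2 lA lA2 lZ lZ2
  simp only [zero_smul, add_zero]
  have ha := al_pos η hη w.1
  have hz := al_pos η hη w.2
  obtain ⟨A1, A2⟩ := pow_hess (q / 2) (‖w.1‖ ^ 2 + η ^ 2) (2 * inner ℝ w.1 h.1) (2 * ‖h.1‖ ^ 2)
    (by linarith) ha (al_cs η w.1 h.1) (by positivity) (q - 1) (by linarith) (by linarith)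
    (by linarith)
  obtain ⟨Z1, Z2⟩ := pow_hess (p / 2) (‖w.2‖ ^ 2 + η ^ 2) (2 * inner ℝ w.2 h.2) (2 * ‖h.2‖ ^ 2)
    (by linarith) hz (al_cs η w.2 h.2) (by positivity) 1 (by linarith) (by linarith)
    (by linarith)
  have hqp : 2 * (q / 2) / (q - 1) = p := by
    have : q - 1 ≠ 0 := by linarith
    field_simp; linarith
  rw [hqp] at A2
  rw [show 2 * (p / 2) / 1 = p by ring] at Z2
  have key := bell_scalar (5 * p) p (2 / q - 1) _ _ _ _ _ _ (‖w.2‖ ^ 2 + η ^ 2)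
    (2 * inner ℝ w.2 h.2) (2 * ‖h.2‖ ^ 2)
    (by linarith) rfl
    (by rw [sub_nonneg, le_div_iff₀ (by linarith)]; linarith)
    (by rw [sub_le_iff_le_add, div_le_iff₀ (by linarith)]; linarith)
    (Real.rpow_pos_of_pos ha (q / 2)) (Real.rpow_pos_of_pos hz (p / 2))
    (le_trans (by have : 0 < q - 1 := by linarith
                  positivity) A1)
    (le_trans (by positivity) Z1) hz (by positivity) A2 Z2 (al_cs η w.2 h.2)
    (bell_zeta q p _ _ hq1 hq2 hpq (by positivity) hz)
  have e : ((‖w.1‖ ^ 2 + η ^ 2) ^ (q / 2)) ^ (2 / q - 1) = (‖w.1‖ ^ 2 + η ^ 2) ^ (1 - q / 2) := by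
    rw [← Real.rpow_mul ha.le]
    congr 1
    field_simp
  rw [e] at key
  refine le_trans (le_of_eq ?_) (key.trans (le_of_eq ?_))
  · ring
  · ring

theorem bell_low {E F : Type*} [NormedAddCommGroup E] [InnerProductSpace ℝ E]
    [NormedAddCommGroup F] [InnerProductSpace ℝ F] (q p η : ℝ)
    (hq1 : 1 < q) (hq2 : q < 2) (hpq : p * (q - 1) = q) (hη : 0 < η) (a b : E × F) :
    bell q p η a - bell q p η b + 0 ≤ fderiv ℝ (bell q p η) a (a - b) := by
  have := taylor_low (bell q p η) (bell_hess q p η hq1 hq2 hpq hη a a).1 a b 0 (by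
    intro s _ _
    refine le_trans ?_ (bell_hess q p η hq1 hq2 hpq hη _ _).2
    have := al_pos η hη (a + s • (b - a)).1
    positivity)
  simpa using this

theorem fourier_pars {G K : Type*} [Fintype G] [Fintype K] [DecidableEq K] (χ : K → G → ℂ)
    (orth : ∀ k l, ∑ x, χ k x * conj (χ l x) = if k = l then (Fintype.card G : ℂ) else 0)
    (A B : K → ℂ) :
    ∑ x, (∑ k, A k * χ k x) * conj (∑ k, B k * χ k x)
      = (Fintype.card G : ℂ) * ∑ k, A k * conj (B k) := by
  simp only [map_sum, map_mul, Finset.sum_mul_sum]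
  rw [Finset.sum_comm, Finset.mul_sum]
  refine Finset.sum_congr rfl fun k _ => ?_
  rw [Finset.sum_comm]
  have : ∀ l, ∑ x, A k * χ k x * (conj (B l) * conj (χ l x))
      = A k * conj (B l) * (if k = l then (Fintype.card G : ℂ) else 0) := by
    intro l
    rw [← orth, Finset.mul_sum]
    exact Finset.sum_congr rfl fun x _ => by ring
  simp only [this, mul_ite, mul_zero, Finset.sum_ite_eq, Finset.mem_univ, if_true]
  ring

theorem fourier_inv {G K : Type*} [Fintype G] [Nonempty G] [Fintype K] [DecidableEq G] (χ : K → G → ℂ)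
    (comp : ∀ x y, ∑ k, χ k x * conj (χ k y) = if x = y then (Fintype.card G : ℂ) else 0)
    (f : G → ℂ) (x : G) :
    ∑ k, ((Fintype.card G : ℂ)⁻¹ * ∑ y, f y * conj (χ k y)) * χ k x = f x := by
  have h0 : (Fintype.card G : ℂ) ≠ 0 := by simp
  have : ∀ k, ((Fintype.card G : ℂ)⁻¹ * ∑ y, f y * conj (χ k y)) * χ k x
    = ∑ y, (Fintype.card G : ℂ)⁻¹ * f y * (χ k x * conj (χ k y)) := by
    intro k
    rw [Finset.mul_sum, Finset.sum_mul]
    exact Finset.sum_congr rfl fun y _ => by ring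
  simp only [this]
  rw [Finset.sum_comm]
  simp only [← Finset.mul_sum, comp]
  simp only [mul_ite, mul_zero, Finset.sum_ite_eq, Finset.mem_univ, if_true]
  field_simp

theorem psi_deriv (ω : ℝ) (hω : ω ≠ 0) (t : ℝ) :
    HasDerivAt (fun t => -(t + 1 / (2 * ω)) * Real.exp (-(2 * t * ω)))
      (2 * ω * t * Real.exp (-(2 * t * ω))) t := by
  have h0 : HasDerivAt (fun t => -(2 * t * ω)) (-(2 * ω)) t := by
    have := (((hasDerivAt_id' t).const_mul 2).mul_const ω).fun_neg
    simpa using this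
  have h1 : HasDerivAt (fun t => -(t + 1 / (2 * ω))) (-1) t :=
    ((hasDerivAt_id' t).add_const _).fun_neg
  refine (h1.fun_mul h0.exp).congr_deriv ?_
  field_simp; ring

theorem psi_lim (ω : ℝ) (hω : 0 < ω) :
    Filter.Tendsto (fun t => -(t + 1 / (2 * ω)) * Real.exp (-(2 * t * ω))) Filter.atTop (nhds 0) := by
  have hl : Filter.Tendsto (fun t : ℝ => 2 * t * ω) Filter.atTop Filter.atTop :=
    (Filter.tendsto_id.const_mul_atTop (by norm_num : (0 : ℝ) < 2)).atTop_mul_const hω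
  have h1 := (Real.tendsto_pow_mul_exp_neg_atTop_nhds_zero 1).comp hl
  have h0 := (Real.tendsto_pow_mul_exp_neg_atTop_nhds_zero 0).comp hl
  have := (h1.add h0).const_mul (-(1 / (2 * ω)))
  simp only [add_zero, mul_zero] at this
  refine this.congr fun t => ?_
  simp only [Function.comp]
  field_simp

theorem chi_L {G ι K : Type*} [AddCommGroup G] [Fintype ι] (χ : K → G → ℂ) (e : ι → G)
    (hmul : ∀ k x y, χ k (x + y) = χ k x * χ k y)
    (hneg : ∀ k x, χ k (-x) = conj (χ k x))
    (hunit : ∀ k x, χ k x * conj (χ k x) = 1) (k : K) (x : G) :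
    ((1 / 2 * Real.sqrt (∑ j, ‖1 - χ k (e j)‖ ^ 2)) ^ 2) • χ k x
      = (1 / 4 : ℝ) • ∑ j, ((χ k x - χ k (x + e j)) + (χ k x - χ k (x - e j))) := by
  rw [mul_pow, Real.sq_sqrt (Finset.sum_nonneg fun j _ => by positivity), mul_smul,
    show (1 / 2 : ℝ) ^ 2 = 1 / 4 by norm_num, Finset.sum_smul]
  congr 1
  refine Finset.sum_congr rfl fun j _ => ?_
  rw [sub_eq_add_neg x (e j), hmul, hmul, hneg, Complex.real_smul]
  have : ((‖1 - χ k (e j)‖ ^ 2 : ℝ) : ℂ) = (1 - χ k (e j)) * conj (1 - χ k (e j)) := by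
    rw [Complex.mul_conj, Complex.normSq_eq_norm_sq]
  rw [this, map_sub, map_one]
  have h := hunit k (e j)
  linear_combination (χ k x) * h

theorem bilin_pt (κ W Wi g h : ℝ) (hκ : 0 < κ) (hW : 0 < W) (hWi : W⁻¹ ≤ Wi) :
    2 * (g * h) ≤ κ * (Wi * g ^ 2) + κ⁻¹ * (W * h ^ 2) := by
  have h1 : κ * (W⁻¹ * g ^ 2) ≤ κ * (Wi * g ^ 2) := by gcongr
  have h2 : 0 ≤ (κ * W⁻¹) * (g - κ⁻¹ * W * h) ^ 2 := by positivity
  have h3 : (κ * W⁻¹) * (g - κ⁻¹ * W * h) ^ 2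
      = κ * (W⁻¹ * g ^ 2) + κ⁻¹ * (W * h ^ 2) - 2 * (g * h) := by
    field_simp; ring
  linarith

theorem bilin {G ι K : Type*} [Fintype G] [AddCommGroup G] [Fintype ι]
    [Fintype K] [DecidableEq K] (χ : K → G → ℂ) (e : ι → G)
    (hmul : ∀ k x y, χ k (x + y) = χ k x * χ k y)
    (hneg : ∀ k x, χ k (-x) = conj (χ k x))
    (hunit : ∀ k x, χ k x * conj (χ k x) = 1)
    (orth : ∀ k l, ∑ x, χ k x * conj (χ l x) = if k = l then (Fintype.card G : ℂ) else 0)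
    (q p η κ : ℝ) (hq1 : 1 < q) (hq2 : q < 2) (hpq : p * (q - 1) = q) (hη : 0 < η) (hκ : 0 < κ)
    (a : K → ℂ) (b : K → ι → ℂ) (ω : K → ℝ)
    (hωdef : ∀ k, ω k = 1 / 2 * Real.sqrt (∑ j, ‖1 - χ k (e j)‖ ^ 2)) :
    (∑ j, ∑ x, (∑ k, ((1 - χ k (e j)) / (2 * ω k) * a k) * χ k x)
        * conj (∑ k, b k j * χ k x)).re
      ≤ κ * (8 / (q * (q - 1))) * ∑ x, (‖∑ k, a k * χ k x‖ ^ 2 + η ^ 2) ^ (q / 2)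
        + κ⁻¹ * ((5 * p + 1) * ∑ x,
          ((‖∑ k, a k * χ k x‖ ^ 2 + ∑ j, ‖∑ k, a k * χ k (x + e j)‖ ^ 2 + η ^ 2) ^ (q / 2)
            + (∑ j, ‖∑ k, b k j * χ k x‖ ^ 2 + η ^ 2) ^ (p / 2))) := by
  have hω : ∀ k, 0 ≤ ω k := fun k => by rw [hωdef]; positivity
  have hω0 : ∀ k, ω k = 0 → ∀ j, 1 - χ k (e j) = 0 := by
    intro k hk j
    rw [hωdef] at hk
    have h1 : Real.sqrt (∑ j, ‖1 - χ k (e j)‖ ^ 2) = 0 := by linarith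
    rw [Real.sqrt_eq_zero (Finset.sum_nonneg fun j _ => by positivity)] at h1
    rw [Finset.sum_eq_zero_iff_of_nonneg (fun j _ => by positivity)] at h1
    simpa using h1 j (Finset.mem_univ j)
  have hchi : ∀ k x, (ω k) ^ 2 • χ k x
      = (1 / 4 : ℝ) • ∑ j, ((χ k x - χ k (x + e j)) + (χ k x - χ k (x - e j))) := by
    intro k x
    rw [hωdef]
    exact chi_L χ e hmul hneg hunit k x
  have hqq : 0 < q * (q - 1) := mul_pos (by linarith) (by linarith)
  have hp : 0 < p := by
    by_contra h
    push Not at h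
    nlinarith
  -- first flow
  obtain ⟨U1, U1', dU1, low1, neg1, zero1⟩ := flow e (fun k x => a k * χ k x) ω hω
    (by
      intro k x
      simp only [← mul_sub, ← mul_add, ← Finset.mul_sum]
      rw [← mul_smul_comm, hchi, mul_smul_comm])
    (fun u : ℂ => (‖u‖ ^ 2 + η ^ 2) ^ (q / 2)) (phi_hess q η hq1 hq2 hη (0 : ℂ) 0).1
    (fun w => by positivity) (fun _ _ => 0) (fun _ _ => le_rfl)
    (fun w h => le_trans (by have := hqq.le
                             positivity) (phi_hess q η hq1 hq2 hη w h).2)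
    (fun a b => (q * (q - 1) / 2) * ((max ‖a‖ ‖b‖) ^ 2 + η ^ 2) ^ (q / 2 - 1) * ‖a - b‖ ^ 2)
    (fun a b => by have := hqq.le
                   positivity)
    (fun a b => phi_low q η hq1 hq2 hη a b)
  -- second flow
  set e' : Option ι → G := fun o => o.elim 0 e with he'
  obtain ⟨U2, U2', dU2, low2, neg2, zero2⟩ := flow
    (E := EuclideanSpace ℂ (Option ι) × EuclideanSpace ℂ ι) e
    (fun k x => χ k x • ((WithLp.toLp 2 (fun o => a k * χ k (e' o)) : EuclideanSpace ℂ (Option ι)),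
      (WithLp.toLp 2 (fun j => b k j) : EuclideanSpace ℂ ι))) ω hω
    (by
      intro k x
      simp only [← sub_smul, ← add_smul, ← Finset.sum_smul]
      rw [← smul_assoc, hchi, smul_assoc])
    (bell q p η) (bell_hess q p η hq1 hq2 hpq hη 0 0).1
    (fun w => (bell_bounds q p η hq1 hq2 hpq hη w).1)
    (fun w h => (‖w.1‖ ^ 2 + η ^ 2) ^ (1 - q / 2) * ‖h.2‖ ^ 2) (fun w h => by positivity)
    (fun w h => (bell_hess q p η hq1 hq2 hpq hη w h).2)
    (fun _ _ => 0) (fun _ _ => le_rfl)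
    (fun a b => bell_low q p η hq1 hq2 hpq hη a b)
  set u : ℝ → G → ℂ := fun t x => ∑ k, Real.exp (-(t * ω k)) • (a k * χ k x) with hu
  set v1 : ℝ → G → ι → ℂ := fun t x j => ∑ k, (-ω k * Real.exp (-(t * ω k))) • (χ k x * b k j)
    with hv1
  have hu' : ∀ t x, u t x = ∑ k, (a k * (Real.exp (-(t * ω k)) : ℂ)) * χ k x := by
    intro t x
    simp only [hu, Complex.real_smul]
    exact Finset.sum_congr rfl fun k _ => by push_cast; ring
  have hv1' : ∀ t x j, v1 t x j
      = ∑ k, (b k j * ((-ω k * Real.exp (-(t * ω k)) : ℝ) : ℂ)) * χ k x := by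
    intro t x j
    simp only [hv1, Complex.real_smul]
    exact Finset.sum_congr rfl fun k _ => by ring
  have hgr : ∀ t x j, u t x - u t (x + e j)
      = ∑ k, ((1 - χ k (e j)) * a k * (Real.exp (-(t * ω k)) : ℂ)) * χ k x := by
    intro t x j
    rw [hu', hu', ← Finset.sum_sub_distrib]
    refine Finset.sum_congr rfl fun k _ => ?_
    rw [hmul]; ring
  have hN1 : ∀ t x, ‖(∑ k, Real.exp (-(t * ω k)) • (χ k x •
      ((WithLp.toLp 2 (fun o => a k * χ k (e' o)) : EuclideanSpace ℂ (Option ι)),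
      (WithLp.toLp 2 (fun j => b k j) : EuclideanSpace ℂ ι)))).1‖ ^ 2
      = ‖u t x‖ ^ 2 + ∑ j, ‖u t (x + e j)‖ ^ 2 := by
    intro t x
    rw [Prod.fst_sum, EuclideanSpace.norm_sq_eq, Fintype.sum_option]
    have h0 : ∀ k, χ k 0 = 1 := by
      intro k
      have h1 := hmul k 0 0
      have h2 := hunit k 0
      rw [add_zero] at h1
      have h3 : χ k 0 ≠ 0 := by
        intro h
        simp [h] at h2
      field_simp at h1
      exact h1.symm
    have h1 : ∀ o : Option ι, (∑ k, (Real.exp (-(t * ω k)) • (χ k x •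
      ((WithLp.toLp 2 (fun o => a k * χ k (e' o)) : EuclideanSpace ℂ (Option ι)),
      (WithLp.toLp 2 (fun j => b k j) : EuclideanSpace ℂ ι)))).1) o = u t (x + e' o) := by
      intro o
      simp only [hu, WithLp.ofLp_sum, Finset.sum_apply, Prod.smul_fst, PiLp.smul_apply, smul_eq_mul,
        hmul]
      refine Finset.sum_congr rfl fun k _ => ?_
      congr 1; ring
    simp only [h1]
    simp [he']
  have hN2 : ∀ (t : ℝ) x (z : K → ℝ), ‖(∑ k, z k • (χ k x •
      ((WithLp.toLp 2 (fun o => a k * χ k (e' o)) : EuclideanSpace ℂ (Option ι)),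
      (WithLp.toLp 2 (fun j => b k j) : EuclideanSpace ℂ ι)))).2‖ ^ 2
      = ∑ j, ‖∑ k, z k • (χ k x * b k j)‖ ^ 2 := by
    intro t x z
    rw [Prod.snd_sum, EuclideanSpace.norm_sq_eq]
    refine Finset.sum_congr rfl fun j _ => ?_
    simp only [WithLp.ofLp_sum, Finset.sum_apply, Prod.smul_snd, PiLp.smul_apply, smul_eq_mul]
  set n : ℂ := (Fintype.card G : ℂ) with hn
  set D : K → ℂ := fun k => n * ∑ j, (1 - χ k (e j)) * a k * conj (b k j) with hD
  -- pairing identity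
  have hpair : ∀ t, (∑ j, ∑ x, (u t x - u t (x + e j)) * conj (v1 t x j))
      = ∑ k, -(D k * ((ω k * Real.exp (-(2 * t * ω k)) : ℝ) : ℂ)) := by
    intro t
    simp only [hgr, hv1', fourier_pars χ orth, ← Finset.mul_sum]
    rw [Finset.sum_comm, Finset.mul_sum]
    refine Finset.sum_congr rfl fun k _ => ?_
    simp only [hD, Finset.sum_mul, Finset.mul_sum, ← Finset.sum_neg_distrib]
    refine Finset.sum_congr rfl fun j _ => ?_
    rw [map_mul, Complex.conj_ofReal]
    rw [show -(2 * t * ω k) = -(t * ω k) + -(t * ω k) by ring, Real.exp_add]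
    push_cast
    ring
  have hpair0 : (∑ j, ∑ x, (∑ k, ((1 - χ k (e j)) / (2 * ω k) * a k) * χ k x)
        * conj (∑ k, b k j * χ k x)) = ∑ k, D k * ((1 / (2 * ω k) : ℝ) : ℂ) := by
    simp only [fourier_pars χ orth, ← Finset.mul_sum]
    rw [Finset.sum_comm, Finset.mul_sum]
    refine Finset.sum_congr rfl fun k _ => ?_
    simp only [hD, Finset.sum_mul, Finset.mul_sum]
    refine Finset.sum_congr rfl fun j _ => ?_
    push_cast
    ring
  set Ψ : ℝ → ℝ := fun t => ∑ k, (D k).re * (-(t + 1 / (2 * ω k)) * Real.exp (-(2 * t * ω k)))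
    with hΨ
  have hD0 : ∀ k, ω k = 0 → D k = 0 := by
    intro k hk
    simp only [hD]
    simp [hω0 k hk]
  have dΨ : ∀ t, HasDerivAt Ψ (∑ k, (D k).re * (2 * ω k * t * Real.exp (-(2 * t * ω k)))) t := by
    intro t
    refine HasDerivAt.fun_sum fun k _ => ?_
    by_cases hk : ω k = 0
    · simp only [hD0 k hk, Complex.zero_re, zero_mul]
      exact hasDerivAt_const _ _
    · exact (psi_deriv (ω k) hk t).const_mul _
  have limΨ : Filter.Tendsto Ψ Filter.atTop (nhds 0) := by
    have : (0 : ℝ) = ∑ k : K, (0 : ℝ) := by simp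
    rw [this]
    refine tendsto_finsetSum _ fun k _ => ?_
    by_cases hk : ω k = 0
    · simp only [hD0 k hk, Complex.zero_re, zero_mul]
      exact tendsto_const_nhds
    · have := (psi_lim (ω k) (lt_of_le_of_ne (hω k) (Ne.symm hk))).const_mul (D k).re
      simpa using this
  have hΨ0 : -Ψ 0 = (∑ k, D k * ((1 / (2 * ω k) : ℝ) : ℂ)).re := by
    simp only [hΨ, Complex.re_sum, Complex.re_mul_ofReal, ← Finset.sum_neg_distrib]
    refine Finset.sum_congr rfl fun k _ => ?_
    simp
  have hdom : ∀ t, 0 ≤ t → ∑ k, (D k).re * (2 * ω k * t * Real.exp (-(2 * t * ω k)))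
      ≤ κ * (8 / (q * (q - 1))) * U1' t + κ⁻¹ * U2' t := by
    intro t ht
    have l1 := low1 t ht
    have l2 := low2 t ht
    simp only [hN1 t, hN2 t] at l2
    have e0 : ∑ k, (D k).re * (2 * ω k * t * Real.exp (-(2 * t * ω k)))
        = t * ∑ x, ∑ j, -2 * ((u t x - u t (x + e j)) * conj (v1 t x j)).re := by
      rw [Finset.sum_comm]
      simp only [← Finset.mul_sum, ← Complex.re_sum]
      rw [hpair]
      simp only [Complex.re_sum, Complex.neg_re, Complex.re_mul_ofReal, Finset.mul_sum]
      refine Finset.sum_congr rfl fun k _ => ?_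
      ring
    rw [e0]
    have hWpos : ∀ x, 0 < ‖u t x‖ ^ 2 + ∑ j, ‖u t (x + e j)‖ ^ 2 + η ^ 2 := by
      intro x; positivity
    have hpt : ∀ x, ∑ j, -2 * ((u t x - u t (x + e j)) * conj (v1 t x j)).re
        ≤ κ * (8 / (q * (q - 1))) * (0 + 1 / 4 * ∑ j, (q * (q - 1) / 2) *
          ((max ‖u t x‖ ‖u t (x + e j)‖) ^ 2 + η ^ 2) ^ (q / 2 - 1) * ‖u t x - u t (x + e j)‖ ^ 2)
        + κ⁻¹ * ((‖u t x‖ ^ 2 + ∑ j, ‖u t (x + e j)‖ ^ 2 + η ^ 2) ^ (1 - q / 2)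
            * ∑ j, ‖v1 t x j‖ ^ 2 + 1 / 4 * ∑ j : ι, 0) := by
      intro x
      have e1 : κ * (8 / (q * (q - 1))) * (0 + 1 / 4 * ∑ j, (q * (q - 1) / 2) *
          ((max ‖u t x‖ ‖u t (x + e j)‖) ^ 2 + η ^ 2) ^ (q / 2 - 1) * ‖u t x - u t (x + e j)‖ ^ 2)
        = ∑ j, κ * (((max ‖u t x‖ ‖u t (x + e j)‖) ^ 2 + η ^ 2) ^ (q / 2 - 1)
            * ‖u t x - u t (x + e j)‖ ^ 2) := by
        rw [zero_add, Finset.mul_sum, Finset.mul_sum]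
        refine Finset.sum_congr rfl fun j _ => ?_
        have : q - 1 ≠ 0 := by linarith
        field_simp
        norm_num
      rw [e1, Finset.sum_const_zero, mul_zero, add_zero, Finset.mul_sum, Finset.mul_sum,
        ← Finset.sum_add_distrib]
      refine Finset.sum_le_sum fun j _ => ?_
      refine le_trans ?_ (bilin_pt κ _ _ _ _ hκ (Real.rpow_pos_of_pos (hWpos x) _) ?_)
      · have h1 := Complex.abs_re_le_norm ((u t x - u t (x + e j)) * conj (v1 t x j))
        rw [norm_mul, RCLike.norm_conj] at h1
        have h2 := neg_abs_le ((u t x - u t (x + e j)) * conj (v1 t x j)).re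
        linarith
      · rw [← Real.rpow_neg (hWpos x).le, neg_sub]
        apply Real.rpow_le_rpow_of_nonpos (by positivity) _ (by linarith)
        have hs : ‖u t (x + e j)‖ ^ 2 ≤ ∑ j, ‖u t (x + e j)‖ ^ 2 :=
          Finset.single_le_sum (f := fun j => ‖u t (x + e j)‖ ^ 2)
            (fun i _ => by positivity) (Finset.mem_univ j)
        have hs0 : 0 ≤ ‖u t x‖ ^ 2 := by positivity
        have hs1 : 0 ≤ ‖u t (x + e j)‖ ^ 2 := by positivity
        rcases max_cases ‖u t x‖ ‖u t (x + e j)‖ with h | h <;> rw [h.1] <;> linarith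
    calc t * ∑ x, ∑ j, -2 * ((u t x - u t (x + e j)) * conj (v1 t x j)).re
        ≤ t * ∑ x, _ := mul_le_mul_of_nonneg_left (Finset.sum_le_sum fun x _ => hpt x) ht
      _ = κ * (8 / (q * (q - 1))) * (t * ∑ x, _) + κ⁻¹ * (t * ∑ x, _) := by
        rw [Finset.sum_add_distrib, ← Finset.mul_sum, ← Finset.mul_sum]
        ring
      _ ≤ _ := add_le_add
          (mul_le_mul_of_nonneg_left l1 (mul_nonneg hκ.le (div_nonneg (by norm_num) hqq.le)))
          (mul_le_mul_of_nonneg_left l2 (by positivity))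
  set V : ℝ → ℝ := fun t => κ * (8 / (q * (q - 1))) * U1 t + κ⁻¹ * U2 t - Ψ t with hV
  have dV : ∀ t, HasDerivAt V (κ * (8 / (q * (q - 1))) * U1' t + κ⁻¹ * U2' t
      - ∑ k, (D k).re * (2 * ω k * t * Real.exp (-(2 * t * ω k)))) t := fun t =>
    (((dU1 t).const_mul _).fun_add ((dU2 t).const_mul _)).fun_sub (dΨ t)
  have monoV : MonotoneOn V (Set.Ici 0) := by
    apply monotoneOn_of_deriv_nonneg (convex_Ici 0)
    · exact fun x _ => (dV x).continuousAt.continuousWithinAt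
    · exact fun x _ => (dV x).differentiableAt.differentiableWithinAt
    · intro x hx
      rw [(dV x).deriv]
      simp at hx
      linarith [hdom x hx.le]
  have hV0 : V 0 ≤ 0 := by
    have hle : ∀ t, 0 ≤ t → V 0 ≤ -Ψ t := by
      intro t ht
      have h1 := monoV (Set.mem_Ici.2 le_rfl) (Set.mem_Ici.2 ht) ht
      have h2 : κ * (8 / (q * (q - 1))) * U1 t ≤ 0 :=
        mul_nonpos_of_nonneg_of_nonpos (mul_nonneg hκ.le (div_nonneg (by norm_num) hqq.le))
          (neg1 t ht)
      have h3 : κ⁻¹ * U2 t ≤ 0 := mul_nonpos_of_nonneg_of_nonpos (by positivity) (neg2 t ht)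
      have h4 : V t = κ * (8 / (q * (q - 1))) * U1 t + κ⁻¹ * U2 t - Ψ t := rfl
      linarith
    have hl := limΨ.neg
    rw [neg_zero] at hl
    refine ge_of_tendsto hl ?_
    filter_upwards [Filter.eventually_ge_atTop 0] with t ht using hle t ht
  rw [hpair0, ← hΨ0]
  have h4 : V 0 = κ * (8 / (q * (q - 1))) * U1 0 + κ⁻¹ * U2 0 - Ψ 0 := rfl
  rw [h4, zero1, zero2] at hV0
  have hb : ∑ x, bell q p η (∑ k, χ k x •
      ((WithLp.toLp 2 (fun o => a k * χ k (e' o)) : EuclideanSpace ℂ (Option ι)),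
      (WithLp.toLp 2 (fun j => b k j) : EuclideanSpace ℂ ι)))
      ≤ (5 * p + 1) * ∑ x,
          ((‖∑ k, a k * χ k x‖ ^ 2 + ∑ j, ‖∑ k, a k * χ k (x + e j)‖ ^ 2 + η ^ 2) ^ (q / 2)
            + (∑ j, ‖∑ k, b k j * χ k x‖ ^ 2 + η ^ 2) ^ (p / 2)) := by
    rw [Finset.mul_sum]
    refine Finset.sum_le_sum fun x _ => ?_
    refine (bell_bounds q p η hq1 hq2 hpq hη _).2.trans (le_of_eq ?_)
    have g1 := hN1 0 x
    have g2 := hN2 0 x (fun _ => 1)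
    simp only [hu, zero_mul, neg_zero, Real.exp_zero, one_smul] at g1 g2
    rw [g1, g2]
    simp only [mul_comm (χ _ x) (b _ _)]
  have := mul_le_mul_of_nonneg_left hb (inv_nonneg.2 hκ.le)
  linarith

theorem opt_real (q p A B d F N : ℝ) (hq1 : 1 < q) (hq2 : q < 2) (hpq : p * (q - 1) = q)
    (hA : 0 < A) (hB : 0 < B) (hd : 1 ≤ d) (hF : 0 ≤ F) (hN : 0 ≤ N)
    (h : ∀ κ l : ℝ, 0 < κ → 0 < l → l * N ≤ κ * A * F + κ⁻¹ * (B * ((d + 1) * F + l ^ p * N))) :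
    N ≤ (A + 3 * B) ^ q * d ^ (1 - q / 2) * F := by
  rcases hN.eq_or_lt with hN | hN
  · rw [← hN]; positivity
  rcases hF.eq_or_lt with hF | hF
  · have := h (2 * B) 1 (by positivity) one_pos
    rw [← hF] at this
    simp only [Real.one_rpow] at this
    have e : (2 * B)⁻¹ * (B * ((d + 1) * 0 + 1 * N)) = N / 2 := by field_simp; ring
    rw [e] at this
    linarith
  have hd0 : 0 < d := by linarith
  have hp : 0 < p := by
    by_contra h
    push Not at h
    nlinarith
  have hc : 0 < d * F / N := by positivity
  have hs : 0 < Real.sqrt d := Real.sqrt_pos.2 hd0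
  have hss : Real.sqrt d * Real.sqrt d = d := Real.mul_self_sqrt hd0.le
  have h1 := h (Real.sqrt d) ((d * F / N) ^ (1 / p)) hs (by positivity)
  rw [← Real.rpow_mul hc.le, one_div_mul_cancel hp.ne', Real.rpow_one,
    div_mul_cancel₀ _ hN.ne'] at h1
  have h2 : (d * F / N) ^ (1 / p) * N ≤ Real.sqrt d * (A + 3 * B) * F := by
    refine h1.trans ?_
    have e : (Real.sqrt d)⁻¹ * d = Real.sqrt d := by
      field_simp; nlinarith
    have : (Real.sqrt d)⁻¹ * (B * ((d + 1) * F + d * F)) ≤ (Real.sqrt d)⁻¹ * d * (3 * B * F) := by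
      rw [mul_assoc]
      refine mul_le_mul_of_nonneg_left ?_ (by positivity)
      nlinarith [mul_pos hB hF]
    rw [e] at this
    linarith
  have h3 := Real.rpow_le_rpow (by positivity) h2 (by linarith : 0 ≤ q)
  have ep : 1 / p * q = q - 1 := by field_simp; linarith
  rw [Real.mul_rpow (by positivity) hN.le, ← Real.rpow_mul hc.le, ep,
    Real.mul_rpow (by positivity) hF.le, Real.mul_rpow (by positivity) (by positivity),
    Real.div_rpow (by positivity) hN.le, Real.mul_rpow hd0.le hF.le,
    Real.sqrt_eq_rpow, ← Real.rpow_mul hd0.le] at h3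
  have eN : N ^ q = N ^ (q - 1) * N := by
    rw [← Real.rpow_add_one hN.ne']; congr 1; ring
  have eF : F ^ q = F ^ (q - 1) * F := by
    rw [← Real.rpow_add_one hF.ne']; congr 1; ring
  have ed : d ^ (1 / 2 * q) = d ^ (q - 1) * d ^ (1 - q / 2) := by
    rw [← Real.rpow_add hd0]; congr 1; ring
  rw [eN, eF, ed] at h3
  have p1 : 0 < N ^ (q - 1) := by positivity
  have p2 : 0 < F ^ (q - 1) := by positivity
  have p3 : 0 < d ^ (q - 1) := by positivity
  have e1 : d ^ (q - 1) * F ^ (q - 1) / N ^ (q - 1) * (N ^ (q - 1) * N)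
    = (d ^ (q - 1) * F ^ (q - 1)) * N := by field_simp
  rw [e1] at h3
  refine le_of_mul_le_mul_left (h3.trans (le_of_eq ?_)) (mul_pos p3 p2)
  ring

theorem sum_rpow_le {ι : Type*} (s : Finset ι) (u : ι → ℝ) (hu : ∀ i, 0 ≤ u i) (r : ℝ) (hr0 : 0 < r)
    (hr1 : r ≤ 1) : (∑ i ∈ s, u i) ^ r ≤ ∑ i ∈ s, u i ^ r := by
  classical
  induction s using Finset.induction_on with
  | empty => simp [Real.zero_rpow hr0.ne']
  | insert i s hi ih =>
    rw [Finset.sum_insert hi, Finset.sum_insert hi]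
    exact (Real.rpow_add_le_add_rpow (hu i) (Finset.sum_nonneg fun j _ => hu j) hr0.le hr1).trans
      (add_le_add le_rfl ih)

theorem finite_main {G ι K : Type*} [Fintype G] [AddCommGroup G] [Fintype ι] [DecidableEq G]
    [Fintype K] [DecidableEq K] (χ : K → G → ℂ) (e : ι → G)
    (hmul : ∀ k x y, χ k (x + y) = χ k x * χ k y)
    (hneg : ∀ k x, χ k (-x) = conj (χ k x))
    (hunit : ∀ k x, χ k x * conj (χ k x) = 1)
    (orth : ∀ k l, ∑ x, χ k x * conj (χ l x) = if k = l then (Fintype.card G : ℂ) else 0)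
    (comp : ∀ x y, ∑ k, χ k x * conj (χ k y) = if x = y then (Fintype.card G : ℂ) else 0)
    (q p : ℝ) (hq1 : 1 < q) (hq2 : q < 2) (hpq : p * (q - 1) = q) (hι : 1 ≤ Fintype.card ι)
    (ω : K → ℝ) (hωdef : ∀ k, ω k = 1 / 2 * Real.sqrt (∑ j, ‖1 - χ k (e j)‖ ^ 2))
    (f : G → ℂ) :
    ∑ x, (∑ j, ‖∑ k, ((1 - χ k (e j)) / (2 * ω k)
        * ((Fintype.card G : ℂ)⁻¹ * ∑ y, f y * conj (χ k y))) * χ k x‖ ^ 2) ^ (q / 2)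
      ≤ (8 / (q * (q - 1)) + 3 * (5 * p + 1)) ^ q * (Fintype.card ι : ℝ) ^ (1 - q / 2)
        * ∑ x, ‖f x‖ ^ q := by
  have hqq : 0 < q * (q - 1) := mul_pos (by linarith) (by linarith)
  have hp : 0 < p := by
    by_contra h
    push Not at h
    nlinarith
  set R : ι → G → ℂ := fun j x => ∑ k, ((1 - χ k (e j)) / (2 * ω k)
        * ((Fintype.card G : ℂ)⁻¹ * ∑ y, f y * conj (χ k y))) * χ k x with hR
  have key : ∀ κ : ℝ, 0 < κ → ∀ g : ι → G → ℂ, (∑ j, ∑ x, R j x * conj (g j x)).re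
      ≤ κ * (8 / (q * (q - 1))) * ∑ x, ‖f x‖ ^ q + κ⁻¹ * ((5 * p + 1) *
        (((Fintype.card ι : ℝ) + 1) * ∑ x, ‖f x‖ ^ q + ∑ x, (∑ j, ‖g j x‖ ^ 2) ^ (p / 2))) := by
    intro κ hκ g
    have hb : ∀ η : ℝ, 0 < η → (∑ j, ∑ x, R j x * conj (g j x)).re
      ≤ κ * (8 / (q * (q - 1))) * ∑ x, (‖f x‖ ^ 2 + η ^ 2) ^ (q / 2)
        + κ⁻¹ * ((5 * p + 1) * ∑ x,
          ((‖f x‖ ^ 2 + ∑ j, ‖f (x + e j)‖ ^ 2 + η ^ 2) ^ (q / 2)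
            + (∑ j, ‖g j x‖ ^ 2 + η ^ 2) ^ (p / 2))) := by
      intro η hη
      have := bilin χ e hmul hneg hunit orth q p η κ hq1 hq2 hpq hη hκ
        (fun k => (Fintype.card G : ℂ)⁻¹ * ∑ y, f y * conj (χ k y))
        (fun k j => (Fintype.card G : ℂ)⁻¹ * ∑ y, g j y * conj (χ k y)) ω hωdef
      simp only [fourier_inv χ comp] at this
      exact this
    have hcont : Continuous fun η : ℝ => κ * (8 / (q * (q - 1))) * ∑ x, (‖f x‖ ^ 2 + η ^ 2) ^ (q / 2)
        + κ⁻¹ * ((5 * p + 1) * ∑ x,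
          ((‖f x‖ ^ 2 + ∑ j, ‖f (x + e j)‖ ^ 2 + η ^ 2) ^ (q / 2)
            + (∑ j, ‖g j x‖ ^ 2 + η ^ 2) ^ (p / 2))) := by
      have c1 : ∀ (c r : ℝ), 0 < r → Continuous fun η : ℝ => (c + η ^ 2) ^ r := fun c r hr =>
        (by fun_prop : Continuous fun η : ℝ => c + η ^ 2).rpow_const fun _ => Or.inr hr.le
      refine (continuous_const.mul (continuous_finsetSum _ fun x _ => c1 _ _ (by linarith))).add
        (continuous_const.mul (continuous_const.mul (continuous_finsetSum _ fun x _ => ?_)))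
      exact (c1 _ _ (by linarith)).add (c1 _ _ (by linarith))
    have hlim := (hcont.tendsto 0).mono_left (nhdsWithin_le_nhds (s := Set.Ioi 0))
    have h0 := ge_of_tendsto hlim (by
      filter_upwards [self_mem_nhdsWithin] with η hη using hb η hη)
    refine h0.trans ?_
    have e2 : ∀ z : ℂ, (‖z‖ ^ 2) ^ (q / 2) = ‖z‖ ^ q := by
      intro z
      rw [← Real.rpow_natCast, ← Real.rpow_mul (norm_nonneg _)]
      congr 1; push_cast; ring
    simp only [ne_eq, OfNat.ofNat_ne_zero, not_false_eq_true, zero_pow, add_zero, e2,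
      Finset.sum_add_distrib]
    gcongr
    calc ∑ x, (‖f x‖ ^ 2 + ∑ j, ‖f (x + e j)‖ ^ 2) ^ (q / 2)
        ≤ ∑ x, (‖f x‖ ^ q + ∑ j, ‖f (x + e j)‖ ^ q) := by
          refine Finset.sum_le_sum fun x _ => ?_
          refine (Real.rpow_add_le_add_rpow (by positivity)
            (Finset.sum_nonneg fun j _ => by positivity) (by linarith) (by linarith)).trans ?_
          rw [e2]
          refine add_le_add le_rfl ((sum_rpow_le _ _ (fun j => by positivity) _ (by linarith)
            (by linarith)).trans (le_of_eq ?_))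
          simp only [e2]
      _ = _ := by
          rw [Finset.sum_add_distrib, Finset.sum_comm]
          have : ∀ j, ∑ x, ‖f (x + e j)‖ ^ q = ∑ x, ‖f x‖ ^ q := fun j =>
            Equiv.sum_comp (Equiv.addRight (e j)) fun x => ‖f x‖ ^ q
          simp only [this, Finset.sum_const, Finset.card_univ, nsmul_eq_mul]
          ring
  refine opt_real q p _ _ _ _ _ hq1 hq2 hpq (by positivity) (by positivity) (by exact_mod_cast hι)
    (by positivity) (by positivity) ?_
  intro κ l hκ hl
  have := key κ hκ fun j x => ((l * (∑ i, ‖R i x‖ ^ 2) ^ ((q - 2) / 2) : ℝ) : ℂ) * R j x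
  have hS : ∀ x, 0 ≤ ∑ i, ‖R i x‖ ^ 2 := fun x => by positivity
  have el : (∑ j, ∑ x, R j x * conj (((l * (∑ i, ‖R i x‖ ^ 2) ^ ((q - 2) / 2) : ℝ) : ℂ) * R j x)).re
      = l * ∑ x, (∑ j, ‖R j x‖ ^ 2) ^ (q / 2) := by
    rw [Finset.sum_comm, Finset.mul_sum, Complex.re_sum]
    refine Finset.sum_congr rfl fun x _ => ?_
    have : ∀ j, R j x * conj (((l * (∑ i, ‖R i x‖ ^ 2) ^ ((q - 2) / 2) : ℝ) : ℂ) * R j x)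
        = ((l * (∑ i, ‖R i x‖ ^ 2) ^ ((q - 2) / 2) * ‖R j x‖ ^ 2 : ℝ) : ℂ) := by
      intro j
      rw [map_mul, Complex.conj_ofReal, mul_left_comm, Complex.mul_conj, Complex.normSq_eq_norm_sq]
      push_cast; rfl
    simp only [this]
    rw [← Complex.ofReal_sum, Complex.ofReal_re, ← Finset.mul_sum, mul_assoc]
    congr 1
    rcases (hS x).eq_or_lt with h | h
    · rw [← h, mul_zero, Real.zero_rpow (by linarith)]
    · rw [← Real.rpow_add_one h.ne']; congr 1; ring
  have er : ∀ x, (∑ j, ‖((l * (∑ i, ‖R i x‖ ^ 2) ^ ((q - 2) / 2) : ℝ) : ℂ) * R j x‖ ^ 2) ^ (p / 2)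
      = l ^ p * (∑ j, ‖R j x‖ ^ 2) ^ (q / 2) := by
    intro x
    have hnn : 0 ≤ l * (∑ i, ‖R i x‖ ^ 2) ^ ((q - 2) / 2) := by positivity
    simp only [norm_mul, mul_pow, Complex.norm_real, Real.norm_eq_abs, sq_abs]
    rw [← Finset.mul_sum]
    rcases (hS x).eq_or_lt with h | h
    · rw [← h, mul_zero, Real.zero_rpow (by linarith), Real.zero_rpow (by linarith), mul_zero]
    · have e1 : (l ^ 2 * ((∑ i, ‖R i x‖ ^ 2) ^ ((q - 2) / 2)) ^ 2) * ∑ i, ‖R i x‖ ^ 2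
          = l ^ 2 * (∑ i, ‖R i x‖ ^ 2) ^ (q - 1) := by
        rw [mul_assoc, ← Real.rpow_natCast ((∑ i, ‖R i x‖ ^ 2) ^ ((q - 2) / 2)), ← Real.rpow_mul h.le,
          ← Real.rpow_add_one h.ne']
        congr 2; push_cast; ring
      rw [e1, Real.mul_rpow (by positivity) (by positivity), ← Real.rpow_mul h.le,
        ← Real.rpow_natCast l, ← Real.rpow_mul hl.le]
      congr 2 <;> push_cast <;> linarith
  rw [el] at this
  simp only [er, ← Finset.mul_sum] at this
  exact this

noncomputable def tchi (d N M : ℕ) [NeZero N] (k x : Fin d → ZMod N) : ℂ :=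
  ∏ i, ZMod.stdAddChar (-(k i - (M : ZMod N)) * x i)

theorem tchi_mul (d N M : ℕ) [NeZero N] (k x y : Fin d → ZMod N) :
    tchi d N M k (x + y) = tchi d N M k x * tchi d N M k y := by
  simp only [tchi, Pi.add_apply, mul_add, AddChar.map_add_eq_mul, Finset.prod_mul_distrib]

theorem tchi_neg (d N M : ℕ) [NeZero N] (k x : Fin d → ZMod N) :
    tchi d N M k (-x) = conj (tchi d N M k x) := by
  simp only [tchi, Pi.neg_apply, mul_neg, map_prod, AddChar.map_neg_eq_conj]

theorem tchi_zero (d N M : ℕ) [NeZero N] (k : Fin d → ZMod N) : tchi d N M k 0 = 1 := by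
  simp [tchi]

theorem tchi_unit (d N M : ℕ) [NeZero N] (k x : Fin d → ZMod N) :
    tchi d N M k x * conj (tchi d N M k x) = 1 := by
  rw [← tchi_neg, ← tchi_mul, add_neg_cancel, tchi_zero]

theorem sum_std (N : ℕ) [NeZero N] (b : ZMod N) :
    ∑ t : ZMod N, ZMod.stdAddChar (b * t) = if b = 0 then (N : ℂ) else 0 := by
  have := AddChar.sum_mulShift b (ZMod.isPrimitive_stdAddChar N)
  simp only [ZMod.card] at this
  simp only [mul_comm b]
  rw [this]
  split_ifs <;> simp

theorem tchi_orth (d N M : ℕ) [NeZero N] (k l : Fin d → ZMod N) :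
    ∑ x, tchi d N M k x * conj (tchi d N M l x)
      = if k = l then (Fintype.card (Fin d → ZMod N) : ℂ) else 0 := by
  simp only [← tchi_neg]
  simp only [tchi, ← Finset.prod_mul_distrib, Pi.neg_apply, ← AddChar.map_add_eq_mul]
  have e : ∀ (x : Fin d → ZMod N) i, -(k i - (M : ZMod N)) * x i + -(l i - (M : ZMod N)) * -x i
    = (l i - k i) * x i := fun x i => by ring
  simp only [e]
  rw [← Fintype.prod_sum (fun i t => ZMod.stdAddChar ((l i - k i) * t))]
  simp only [sum_std, sub_eq_zero]
  split_ifs with h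
  · simp [h, ZMod.card]
  · obtain ⟨i, hi⟩ := Function.ne_iff.1 h
    exact Finset.prod_eq_zero (Finset.mem_univ i) (if_neg (Ne.symm hi))

theorem tchi_comp (d N M : ℕ) [NeZero N] (x y : Fin d → ZMod N) :
    ∑ k, tchi d N M k x * conj (tchi d N M k y)
      = if x = y then (Fintype.card (Fin d → ZMod N) : ℂ) else 0 := by
  simp only [← tchi_neg]
  simp only [tchi, ← Finset.prod_mul_distrib, Pi.neg_apply, ← AddChar.map_add_eq_mul]
  have e : ∀ (k : Fin d → ZMod N) i, -(k i - (M : ZMod N)) * x i + -(k i - (M : ZMod N)) * -y i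
    = (y i - x i) * k i + (M : ZMod N) * (x i - y i) := fun x i => by ring
  simp only [e, AddChar.map_add_eq_mul]
  rw [← Fintype.prod_sum (fun i t => ZMod.stdAddChar ((y i - x i) * t) *
    ZMod.stdAddChar ((M : ZMod N) * (x i - y i)))]
  simp only [← Finset.sum_mul, sum_std, sub_eq_zero]
  split_ifs with h
  · simp [h, ZMod.card]
  · obtain ⟨i, hi⟩ := Function.ne_iff.1 h
    exact Finset.prod_eq_zero (Finset.mem_univ i) (by rw [if_neg (Ne.symm hi), zero_mul])

theorem tchi_int (d N M : ℕ) [NeZero N] (hN : N = 2 * M) (k : Fin d → ZMod N) (z : Fin d → ℤ) :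
    tchi d N M k (fun i => (z i : ZMod N))
      = Complex.exp (-(2 * Real.pi * Complex.I) *
        ∑ i, (z i : ℂ) * ((((k i).val : ℝ) / N - 1 / 2 : ℝ) : ℂ)) := by
  rw [Finset.mul_sum, Complex.exp_sum]
  refine Finset.prod_congr rfl fun i _ => ?_
  have e : -(k i - (M : ZMod N)) * (z i : ZMod N)
      = ((-(((k i).val : ℤ) - M) * z i : ℤ) : ZMod N) := by
    push_cast
    rw [ZMod.natCast_val, ZMod.cast_id]
  rw [e, ZMod.stdAddChar_coe]
  congr 1
  have hM : (M : ℂ) ≠ 0 := by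
    have := NeZero.ne N
    rintro h
    have : M = 0 := by exact_mod_cast h
    omega
  subst hN
  push_cast
  field_simp

theorem riemann (d : ℕ) (F : (Fin d → ℝ) → ℂ) (hm : Measurable F) (B : ℝ) (hb : ∀ ξ, ‖F ξ‖ ≤ B)
    (hc : ∀ᵐ ξ, ContinuousAt F ξ) :
    Filter.Tendsto (fun N : ℕ => ((N : ℂ) ^ d)⁻¹ *
      ∑ k : Fin d → Fin N, F (fun i => ((k i : ℕ) : ℝ) / N - 1 / 2)) Filter.atTop
      (nhds (∫ ξ in Set.Icc (fun _ => -(1 / 2 : ℝ)) (fun _ => (1 / 2 : ℝ)), F ξ)) := by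
  set Q : Set (Fin d → ℝ) := Set.pi Set.univ fun _ => Set.Ico (-(1 / 2 : ℝ)) (1 / 2) with hQ
  have hIcc : (∫ ξ in Set.Icc (fun _ => -(1 / 2 : ℝ)) (fun _ => (1 / 2 : ℝ)), F ξ) = ∫ ξ in Q, F ξ :=
    setIntegral_congr_set (Measure.univ_pi_Ico_ae_eq_Icc).symm
  rw [hIcc]
  set st : ℕ → (Fin d → ℝ) → (Fin d → ℝ) := fun N ξ i => (⌊(N : ℝ) * (ξ i + 1 / 2)⌋ : ℝ) / N - 1 / 2
    with hst
  have hstm : ∀ N, Measurable (st N) := by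
    intro N
    rw [hst]
    refine measurable_pi_lambda _ fun i => ?_
    have : Measurable fun ξ : Fin d → ℝ => ⌊(N : ℝ) * (ξ i + 1 / 2)⌋ := by
      apply Int.measurable_floor.comp
      fun_prop
    exact ((measurable_from_top (f := fun n : ℤ => (n : ℝ) / N - 1 / 2)).comp this)
  have hQv : volume Q < ⊤ := by
    rw [hQ, volume_pi_pi]
    exact ENNReal.prod_lt_top fun i _ => by simp
  have hsum : ∀ N : ℕ, 0 < N → ∫ ξ in Q, F (st N ξ) = ((N : ℂ) ^ d)⁻¹ *
      ∑ k : Fin d → Fin N, F (fun i => ((k i : ℕ) : ℝ) / N - 1 / 2) := by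
    intro N hN
    have hN' : (0 : ℝ) < N := by exact_mod_cast hN
    set cell : (Fin d → Fin N) → Set (Fin d → ℝ) := fun k => Set.pi Set.univ fun i =>
      Set.Ico (((k i : ℕ) : ℝ) / N - 1 / 2) ((((k i : ℕ) : ℝ) + 1) / N - 1 / 2) with hcell
    have hfl : ∀ k, ∀ ξ ∈ cell k, ∀ i, ⌊(N : ℝ) * (ξ i + 1 / 2)⌋ = ((k i : ℕ) : ℤ) := by
      intro k ξ hξ i
      have := hξ i (Set.mem_univ i)
      rw [Int.floor_eq_iff]
      obtain ⟨h1, h2⟩ := this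
      rw [sub_le_iff_le_add, div_le_iff₀ hN'] at h1
      rw [lt_sub_iff_add_lt, lt_div_iff₀ hN'] at h2
      constructor
      · push_cast; linarith
      · push_cast; linarith
    have hU : Q = ⋃ k, cell k := by
      ext ξ
      simp only [Set.mem_iUnion]
      constructor
      · intro hξ
        have hh : ∀ i, 0 ≤ ⌊(N : ℝ) * (ξ i + 1 / 2)⌋ ∧ ⌊(N : ℝ) * (ξ i + 1 / 2)⌋ < N := by
          intro i
          obtain ⟨h1, h2⟩ := hξ i (Set.mem_univ i)
          constructor
          · exact Int.floor_nonneg.2 (mul_nonneg hN'.le (by linarith))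
          · rw [Int.floor_lt]; push_cast; nlinarith
        refine ⟨fun i => ⟨(⌊(N : ℝ) * (ξ i + 1 / 2)⌋).toNat, by have := hh i; omega⟩, ?_⟩
        intro i _
        have e : (((⌊(N : ℝ) * (ξ i + 1 / 2)⌋).toNat : ℕ) : ℝ) = (⌊(N : ℝ) * (ξ i + 1 / 2)⌋ : ℝ) := by
          have := Int.toNat_of_nonneg (hh i).1
          exact_mod_cast this
        constructor
        · simp only [e]
          rw [sub_le_iff_le_add, div_le_iff₀ hN']
          have := Int.floor_le ((N : ℝ) * (ξ i + 1 / 2))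
          linarith
        · simp only [e]
          rw [lt_sub_iff_add_lt, lt_div_iff₀ hN']
          have := Int.lt_floor_add_one ((N : ℝ) * (ξ i + 1 / 2))
          linarith
      · rintro ⟨k, hk⟩ i _
        obtain ⟨h1, h2⟩ := hk i (Set.mem_univ i)
        constructor
        · have : (0 : ℝ) ≤ ((k i : ℕ) : ℝ) / N := by positivity
          linarith
        · have : (((k i : ℕ) : ℝ) + 1) / N ≤ 1 := by
            rw [div_le_one hN']
            exact_mod_cast (k i).2
          linarith
    have hcm : ∀ k, MeasurableSet (cell k) := fun k =>
      MeasurableSet.univ_pi fun i => measurableSet_Ico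
    have hdisj : Pairwise (Function.onFun Disjoint cell) := by
      intro k l hkl
      rw [Function.onFun, Set.disjoint_left]
      intro ξ h1 h2
      apply hkl
      funext i
      have := (hfl k ξ h1 i).symm.trans (hfl l ξ h2 i)
      exact Fin.ext (by exact_mod_cast this)
    have hint : IntegrableOn (fun ξ => F (st N ξ)) Q := by
      refine Measure.integrableOn_of_bounded hQv.ne (hm.comp (hstm N)).aestronglyMeasurable (M := B) ?_
      exact Filter.Eventually.of_forall fun ξ => hb _
    rw [hU, integral_iUnion_fintype hcm hdisj
      (fun k => hint.mono_set (by rw [hU]; exact Set.subset_iUnion _ k)), Finset.mul_sum]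
    refine Finset.sum_congr rfl fun k _ => ?_
    have : ∫ ξ in cell k, F (st N ξ) = ∫ ξ in cell k, F (fun i => ((k i : ℕ) : ℝ) / N - 1 / 2) := by
      refine setIntegral_congr_fun (hcm k) fun ξ hξ => ?_
      show F (st N ξ) = _
      congr 1
      funext i
      simp only [hst]
      rw [hfl k ξ hξ i]
      push_cast; rfl
    rw [this, setIntegral_const]
    have hv : volume.real (cell k) = ((N : ℝ) ^ d)⁻¹ := by
      rw [Measure.real, hcell, volume_pi_pi]
      have : ∀ i, volume (Set.Ico (((k i : ℕ) : ℝ) / N - 1 / 2) ((((k i : ℕ) : ℝ) + 1) / N - 1 / 2))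
        = ENNReal.ofReal ((N : ℝ)⁻¹) := by
        intro i
        rw [Real.volume_Ico]
        congr 1
        field_simp
        ring
      simp only [this, Finset.prod_const, Finset.card_univ, Fintype.card_fin]
      rw [← ENNReal.ofReal_pow (by positivity), ENNReal.toReal_ofReal (by positivity), inv_pow]
    rw [hv, Complex.real_smul]
    push_cast
    rfl
  have hT : Filter.Tendsto (fun N : ℕ => ∫ ξ in Q, F (st N ξ)) Filter.atTop (nhds (∫ ξ in Q, F ξ)) := by
    refine tendsto_integral_of_dominated_convergence (fun _ => B)
      (fun N => (hm.comp (hstm N)).aestronglyMeasurable) ?_ (fun N => Filter.Eventually.of_forall fun ξ => hb _) ?_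
    · exact integrableOn_const hQv.ne
    · refine ae_restrict_of_ae ?_
      filter_upwards [hc] with ξ hξ
      refine hξ.tendsto.comp ?_
      rw [tendsto_pi_nhds]
      intro i
      simp only [hst]
      have h1 := (tendsto_nat_floor_mul_div_atTop (R := ℝ) (a := 1) zero_le_one)
      have h2 : Filter.Tendsto (fun N : ℕ => (⌊(N : ℝ) * (ξ i + 1 / 2)⌋ : ℝ) / N) Filter.atTop
          (nhds (ξ i + 1 / 2)) := by
        have hl : Filter.Tendsto (fun N : ℕ => (ξ i + 1 / 2) - 1 / (N : ℝ)) Filter.atTop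
          (nhds (ξ i + 1 / 2)) := by
          simpa using (tendsto_const_nhds (x := ξ i + 1 / 2)).sub tendsto_one_div_atTop_nhds_zero_nat
        refine tendsto_of_tendsto_of_tendsto_of_le_of_le' hl tendsto_const_nhds ?_ ?_
        · filter_upwards [Filter.eventually_gt_atTop 0] with N hN
          have hN' : (0 : ℝ) < N := by exact_mod_cast hN
          rw [le_div_iff₀ hN', sub_mul, one_div_mul_cancel hN'.ne']
          have := Int.lt_floor_add_one ((N : ℝ) * (ξ i + 1 / 2))
          linarith
        · filter_upwards [Filter.eventually_gt_atTop 0] with N hN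
          have hN' : (0 : ℝ) < N := by exact_mod_cast hN
          rw [div_le_iff₀ hN']
          have := Int.floor_le ((N : ℝ) * (ξ i + 1 / 2))
          linarith
      simpa using h2.sub_const (1 / 2)
  refine hT.congr' ?_
  filter_upwards [Filter.eventually_gt_atTop 0] with N hN using hsum N hN

noncomputable def gsym (d : ℕ) (s : ℤ) (j : Fin d) (ξ : Fin d → ℝ) : ℂ :=
  (1 - Complex.exp (-(2 * Real.pi * Complex.I) * ((s : ℂ) * (ξ j : ℂ)))) / (2 * (sinNorm d ξ : ℂ))

noncomputable def gker (d : ℕ) (s : ℤ) (j : Fin d) (z : Fin d → ℤ) : ℂ :=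
  ∫ ξ in Set.Icc (fun _ => -(1 / 2 : ℝ)) (fun _ => (1 / 2 : ℝ)),
      gsym d s j ξ * Complex.exp (-(2 * Real.pi * Complex.I) * ∑ k, ((z k : ℤ) : ℂ) * (ξ k : ℂ))

theorem norm_one_sub_exp (s : ℤ) (hs : s = 1 ∨ s = -1) (t : ℝ) :
    ‖1 - Complex.exp (-(2 * Real.pi * Complex.I) * ((s : ℂ) * (t : ℂ)))‖ = 2 * |Real.sin (Real.pi * t)| := by
  have e : -(2 * Real.pi * Complex.I) * ((s : ℂ) * (t : ℂ))
    = Complex.I * ((-(2 * Real.pi * s * t) : ℝ) : ℂ) := by push_cast; ring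
  rw [e, norm_sub_rev, Complex.norm_exp_I_mul_ofReal_sub_one, norm_mul, Real.norm_eq_abs,
    Real.norm_eq_abs, abs_two]
  congr 1
  rcases hs with rfl | rfl
  · rw [← abs_neg, ← Real.sin_neg]; congr 2; push_cast; ring
  · congr 2; push_cast; ring

theorem sinNorm_sq_form (d : ℕ) (s : ℤ) (hs : s = 1 ∨ s = -1) (ξ : Fin d → ℝ) :
    1 / 2 * Real.sqrt (∑ j, ‖1 - Complex.exp (-(2 * Real.pi * Complex.I) * ((s : ℂ) * (ξ j : ℂ)))‖ ^ 2)
      = sinNorm d ξ := by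
  simp only [norm_one_sub_exp s hs, mul_pow, sq_abs, sinNorm]
  rw [← Finset.mul_sum, Real.sqrt_mul (by norm_num), Real.sqrt_sq (by norm_num)]
  ring

theorem gsym_norm (d : ℕ) (s : ℤ) (hs : s = 1 ∨ s = -1) (j : Fin d) (ξ : Fin d → ℝ) :
    ‖gsym d s j ξ‖ ≤ 1 := by
  rw [gsym, norm_div, norm_one_sub_exp s hs, norm_mul, Complex.norm_real, Complex.norm_ofNat,
    Real.norm_eq_abs]
  have h0 : 0 ≤ sinNorm d ξ := Real.sqrt_nonneg _
  rw [abs_of_nonneg h0]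
  refine div_le_one_of_le₀ ?_ (by positivity)
  refine mul_le_mul_of_nonneg_left ?_ (by norm_num)
  rw [sinNorm]
  refine Real.abs_le_sqrt ?_
  exact Finset.single_le_sum (f := fun k => Real.sin (Real.pi * ξ k) ^ 2)
    (fun k _ => sq_nonneg _) (Finset.mem_univ j)

theorem exp_norm_one (d : ℕ) (z : Fin d → ℤ) (ξ : Fin d → ℝ) :
    ‖Complex.exp (-(2 * Real.pi * Complex.I) * ∑ k, ((z k : ℤ) : ℂ) * (ξ k : ℂ))‖ = 1 := by
  have e : -(2 * Real.pi * Complex.I) * ∑ k, ((z k : ℤ) : ℂ) * (ξ k : ℂ)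
    = ((-(2 * Real.pi * ∑ k, (z k : ℝ) * ξ k) : ℝ) : ℂ) * Complex.I := by push_cast; ring
  rw [e, Complex.norm_exp_ofReal_mul_I]

theorem sinNorm_cont (d : ℕ) : Continuous (sinNorm d) := by
  unfold sinNorm
  fun_prop

theorem gker_lim (d : ℕ) (hd : 0 < d) (s : ℤ) (hs : s = 1 ∨ s = -1) (j : Fin d) (z : Fin d → ℤ) :
    Filter.Tendsto (fun N : ℕ => ((N : ℂ) ^ d)⁻¹ *
      ∑ k : Fin d → Fin N, (gsym d s j (fun i => ((k i : ℕ) : ℝ) / N - 1 / 2) *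
        Complex.exp (-(2 * Real.pi * Complex.I) * ∑ i, ((z i : ℤ) : ℂ) *
          ((((k i : ℕ) : ℝ) / N - 1 / 2 : ℝ) : ℂ)))) Filter.atTop
      (nhds (gker d s j z)) := by
  have hnum : Continuous fun ξ : Fin d → ℝ =>
      1 - Complex.exp (-(2 * Real.pi * Complex.I) * ((s : ℂ) * (ξ j : ℂ))) := by fun_prop
  have hexp : Continuous fun ξ : Fin d → ℝ =>
      Complex.exp (-(2 * Real.pi * Complex.I) * ∑ k, ((z k : ℤ) : ℂ) * (ξ k : ℂ)) := by fun_prop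
  have hden : Continuous fun ξ : Fin d → ℝ => 2 * (sinNorm d ξ : ℂ) :=
    continuous_const.mul (Complex.continuous_ofReal.comp (sinNorm_cont d))
  refine riemann d (fun ξ => gsym d s j ξ *
    Complex.exp (-(2 * Real.pi * Complex.I) * ∑ k, ((z k : ℤ) : ℂ) * (ξ k : ℂ))) ?_ 1 ?_ ?_
  · exact (hnum.measurable.div hden.measurable).mul hexp.measurable
  · intro ξ
    rw [norm_mul, exp_norm_one, mul_one]
    exact gsym_norm d s hs j ξ
  · haveI : Nonempty (Fin d) := ⟨⟨0, hd⟩⟩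
    have hcount : (Set.range fun (n : Fin d → ℤ) (i : Fin d) => (n i : ℝ)).Countable :=
      Set.countable_range _
    have := hcount.ae_notMem (volume : Measure (Fin d → ℝ))
    filter_upwards [this] with ξ hξ
    refine ContinuousAt.mul (ContinuousAt.div hnum.continuousAt hden.continuousAt ?_) hexp.continuousAt
    intro h0
    have h1 : sinNorm d ξ = 0 := by
      rcases mul_eq_zero.1 h0 with h | h
      · norm_num at h
      · exact_mod_cast h
    rw [sinNorm, Real.sqrt_eq_zero (Finset.sum_nonneg fun j _ => by positivity),
      Finset.sum_eq_zero_iff_of_nonneg (fun j _ => by positivity)] at h1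
    have h2 : ∀ i, ∃ n : ℤ, (n : ℝ) = ξ i := by
      intro i
      have := h1 i (Finset.mem_univ i)
      rw [sq_eq_zero_iff, Real.sin_eq_zero_iff] at this
      obtain ⟨n, hn⟩ := this
      refine ⟨n, ?_⟩
      rw [mul_comm] at hn
      exact mul_left_cancel₀ Real.pi_ne_zero hn
    choose n hn using h2
    exact hξ ⟨n, funext hn⟩

noncomputable def gkerN (d : ℕ) (s : ℤ) (j : Fin d) (N : ℕ) (z : Fin d → ℤ) : ℂ :=
  ((N : ℂ) ^ d)⁻¹ *
      ∑ k : Fin d → Fin N, (gsym d s j (fun i => ((k i : ℕ) : ℝ) / N - 1 / 2) *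
        Complex.exp (-(2 * Real.pi * Complex.I) * ∑ i, ((z i : ℤ) : ℂ) *
          ((((k i : ℕ) : ℝ) / N - 1 / 2 : ℝ) : ℂ)))

theorem gkerN_zmod (d : ℕ) (s : ℤ) (j : Fin d) (N : ℕ) [NeZero N] (z : Fin d → ℤ) :
    gkerN d s j N z = ((N : ℂ) ^ d)⁻¹ *
      ∑ k : Fin d → ZMod N, (gsym d s j (fun i => ((k i).val : ℝ) / N - 1 / 2) *
        Complex.exp (-(2 * Real.pi * Complex.I) * ∑ i, ((z i : ℤ) : ℂ) *
          ((((k i).val : ℝ) / N - 1 / 2 : ℝ) : ℂ))) := by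
  obtain ⟨n, rfl⟩ : ∃ n, N = n + 1 := ⟨N - 1, by have := NeZero.ne N; omega⟩
  rw [gkerN]
  congr 1

theorem torus_ineq (d : ℕ) (hd : 0 < d) (s : ℤ) (hs : s = 1 ∨ s = -1) (q p : ℝ) (hq1 : 1 < q)
    (hq2 : q < 2) (hpq : p * (q - 1) = q) (M : ℕ) (hM : 0 < M) (S T : Finset (Fin d → ℤ))
    (hS : Set.InjOn (fun (z : Fin d → ℤ) (i : Fin d) => (z i : ZMod (2 * M))) S)
    (hT : Set.InjOn (fun (z : Fin d → ℤ) (i : Fin d) => (z i : ZMod (2 * M))) T)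
    (f : (Fin d → ℤ) → ℂ) :
    ∑ x ∈ T, (∑ j, ‖∑ y ∈ S, gkerN d s j (2 * M) (x - y) * f y‖ ^ 2) ^ (q / 2)
      ≤ (8 / (q * (q - 1)) + 3 * (5 * p + 1)) ^ q * (d : ℝ) ^ (1 - q / 2)
        * ∑ y ∈ S, ‖f y‖ ^ q := by
  obtain ⟨N, hN⟩ : ∃ N, N = 2 * M := ⟨_, rfl⟩
  rw [← hN] at hS hT ⊢
  have hNz : NeZero N := ⟨by omega⟩
  set c : (Fin d → ℤ) → (Fin d → ZMod N) := fun z i => (z i : ZMod N) with hc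
  have hcsub : ∀ x y, c (x - y) = c x + -c y := by
    intro x y; funext i; simp [hc, sub_eq_add_neg]
  set E : Fin d → Fin d → ℤ := fun j => Pi.single j s with hE
  have hchiE : ∀ k j, tchi d N M k (c (E j)) = Complex.exp (-(2 * Real.pi * Complex.I) *
      ((s : ℂ) * ((((k j).val : ℝ) / N - 1 / 2 : ℝ) : ℂ))) := by
    intro k j
    rw [hc, tchi_int d N M hN]
    congr 2
    rw [Finset.sum_eq_single j]
    · simp [hE]
    · intro b _ hb
      simp [hE, Pi.single_eq_of_ne hb]
    · simp
  set fN : (Fin d → ZMod N) → ℂ := fun u => ∑ y ∈ S, if c y = u then f y else 0 with hfN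
  set ω : (Fin d → ZMod N) → ℝ := fun k => sinNorm d (fun i => ((k i).val : ℝ) / N - 1 / 2) with hω
  have main := finite_main (tchi d N M) (fun j => c (E j)) (tchi_mul d N M) (tchi_neg d N M)
    (tchi_unit d N M) (tchi_orth d N M) (tchi_comp d N M) q p hq1 hq2 hpq (by rw [Fintype.card_fin]; exact hd) ω
    (by
      intro k
      simp only [hchiE]
      exact (sinNorm_sq_form d s hs (fun i => ((k i).val : ℝ) / N - 1 / 2)).symm) fN
  have hcoef : ∀ k, ∑ u, fN u * conj (tchi d N M k u) = ∑ y ∈ S, f y * tchi d N M k (-c y) := by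
    intro k
    simp only [hfN, Finset.sum_mul, tchi_neg]
    rw [Finset.sum_comm]
    refine Finset.sum_congr rfl fun y _ => ?_
    simp [ite_mul]
  have hR : ∀ j x, ∑ k, ((1 - tchi d N M k (c (E j))) / (2 * ω k)
        * ((Fintype.card (Fin d → ZMod N) : ℂ)⁻¹ * ∑ u, fN u * conj (tchi d N M k u)))
          * tchi d N M k (c x) = ∑ y ∈ S, gkerN d s j N (x - y) * f y := by
    intro j x
    simp only [hcoef, gkerN_zmod, Finset.mul_sum, Finset.sum_mul]
    rw [Finset.sum_comm]
    refine Finset.sum_congr rfl fun y _ => Finset.sum_congr rfl fun k _ => ?_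
    rw [← Finset.mul_sum, ← tchi_int d N M hN k (x - y), hchiE]
    have : tchi d N M k (fun i => (((x - y) i : ℤ) : ZMod N)) = tchi d N M k (c x) * tchi d N M k (-c y) := by
      rw [← tchi_mul, ← hcsub]
    rw [this, gsym]
    simp only [Fintype.card_pi, ZMod.card, Finset.prod_const, Finset.card_univ, Fintype.card_fin]
    push_cast
    ring
  have hF : ∑ u, ‖fN u‖ ^ q = ∑ y ∈ S, ‖f y‖ ^ q := by
    have h1 : ∑ u ∈ S.image c, ‖fN u‖ ^ q = ∑ u, ‖fN u‖ ^ q := by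
      refine Finset.sum_subset (Finset.subset_univ _) fun u _ hu => ?_
      have : fN u = 0 := by
        refine Finset.sum_eq_zero fun y hy => if_neg ?_
        rintro rfl
        exact hu (Finset.mem_image_of_mem _ hy)
      rw [this, norm_zero, Real.zero_rpow (by linarith)]
    rw [← h1, Finset.sum_image hS]
    refine Finset.sum_congr rfl fun y hy => ?_
    congr 2
    simp only [hfN]
    rw [Finset.sum_eq_single y]
    · simp
    · intro b hb hby
      exact if_neg fun h => hby (hS hb hy h)
    · exact fun h => absurd hy h
  rw [hF, Fintype.card_fin] at main
  refine le_trans ?_ main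
  calc _ = ∑ x ∈ T, (∑ j, ‖∑ k, ((1 - tchi d N M k (c (E j))) / (2 * ω k)
        * ((Fintype.card (Fin d → ZMod N) : ℂ)⁻¹ * ∑ u, fN u * conj (tchi d N M k u)))
          * tchi d N M k (c x)‖ ^ 2) ^ (q / 2) := by simp only [hR]
    _ = ∑ u ∈ T.image c, (∑ j, ‖∑ k, ((1 - tchi d N M k (c (E j))) / (2 * ω k)
        * ((Fintype.card (Fin d → ZMod N) : ℂ)⁻¹ * ∑ u, fN u * conj (tchi d N M k u)))
          * tchi d N M k u‖ ^ 2) ^ (q / 2) := by rw [Finset.sum_image hT]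
    _ ≤ _ := Finset.sum_le_sum_of_subset_of_nonneg (Finset.subset_univ _)
      fun u _ _ => by positivity

theorem ev_inj (d : ℕ) (S : Finset (Fin d → ℤ)) : ∀ᶠ M : ℕ in Filter.atTop,
    Set.InjOn (fun (z : Fin d → ℤ) (i : Fin d) => (z i : ZMod (2 * M))) S := by
  filter_upwards [Filter.eventually_gt_atTop (∑ y ∈ S, ∑ i, (y i).natAbs)] with M hM
  intro x hx y hy hxy
  funext i
  have hb : ∀ z ∈ S, (z i).natAbs < M := by
    intro z hz
    refine lt_of_le_of_lt ?_ hM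
    exact (Finset.single_le_sum (f := fun i => (z i).natAbs) (fun _ _ => Nat.zero_le _)
      (Finset.mem_univ i)).trans (Finset.single_le_sum (f := fun z : Fin d → ℤ => ∑ i, (z i).natAbs)
        (fun _ _ => Nat.zero_le _) hz)
  have h1 := hb x hx
  have h2 := hb y hy
  have h3 : ((x i : ℤ) : ZMod (2 * M)) = (y i : ZMod (2 * M)) := congrFun hxy i
  rw [ZMod.intCast_eq_intCast_iff_dvd_sub] at h3
  have := Int.eq_zero_of_abs_lt_dvd h3 (by rw [abs_lt]; push_cast; omega)
  omega

theorem lattice_ineq (d : ℕ) (hd : 0 < d) (s : ℤ) (hs : s = 1 ∨ s = -1) (q p : ℝ) (hq1 : 1 < q)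
    (hq2 : q < 2) (hpq : p * (q - 1) = q) (S T : Finset (Fin d → ℤ)) (f : (Fin d → ℤ) → ℂ) :
    ∑ x ∈ T, (∑ j, ‖∑ y ∈ S, gker d s j (x - y) * f y‖ ^ 2) ^ (q / 2)
      ≤ (8 / (q * (q - 1)) + 3 * (5 * p + 1)) ^ q * (d : ℝ) ^ (1 - q / 2)
        * ∑ y ∈ S, ‖f y‖ ^ q := by
  have h2 : Filter.Tendsto (fun M : ℕ => 2 * M) Filter.atTop Filter.atTop :=
    Filter.tendsto_id.const_mul_atTop' (by norm_num)
  have hlim : Filter.Tendsto (fun M : ℕ =>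
      ∑ x ∈ T, (∑ j, ‖∑ y ∈ S, gkerN d s j (2 * M) (x - y) * f y‖ ^ 2) ^ (q / 2)) Filter.atTop
      (nhds (∑ x ∈ T, (∑ j, ‖∑ y ∈ S, gker d s j (x - y) * f y‖ ^ 2) ^ (q / 2))) := by
    refine tendsto_finsetSum _ fun x _ => ?_
    refine Filter.Tendsto.rpow_const ?_ (Or.inr (by linarith))
    refine tendsto_finsetSum _ fun j _ => ?_
    refine (Filter.Tendsto.norm ?_).pow 2
    refine tendsto_finsetSum _ fun y _ => ?_
    exact ((gker_lim d hd s hs j (x - y)).comp h2).mul_const _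
  refine le_of_tendsto hlim ?_
  filter_upwards [ev_inj d S, ev_inj d T, Filter.eventually_gt_atTop 0] with M h1 h2 h3
  exact torus_ineq d hd s hs q p hq1 hq2 hpq M h3 S T h1 h2 f

theorem fin_bound (d : ℕ) (hd : 0 < d) (s : ℤ) (hs : s = 1 ∨ s = -1) (q p : ℝ) (hq1 : 1 < q)
    (hq2 : q < 2) (hpq : p * (q - 1) = q) (T : Finset (Fin d → ℤ)) (f : (Fin d → ℤ) → ℂ)
    (hf : Summable fun y => ‖f y‖ ^ q) :
    ∑ x ∈ T, (∑ j, ‖fmOp d (gsym d s j) f x‖ ^ 2) ^ (q / 2)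
      ≤ (8 / (q * (q - 1)) + 3 * (5 * p + 1)) ^ q * (d : ℝ) ^ (1 - q / 2)
        * ∑' y, ‖f y‖ ^ q := by
  classical
  have hqq : 0 < q * (q - 1) := mul_pos (by linarith) (by linarith)
  have hp : 0 < p := by
    by_contra h
    push Not at h
    nlinarith
  set a : Finset (Fin d → ℤ) → (Fin d → ℤ) → Fin d → ℂ := fun S x j =>
    if Summable (fun y => gker d s j (x - y) * f y) then ∑ y ∈ S, gker d s j (x - y) * f y else 0
    with ha
  have hfm : ∀ j x, fmOp d (gsym d s j) f x = ∑' y, gker d s j (x - y) * f y := fun j x => rfl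
  have hat : ∀ x j, Filter.Tendsto (fun S => a S x j) Filter.atTop (nhds (fmOp d (gsym d s j) f x)) := by
    intro x j
    rw [hfm]
    by_cases h : Summable (fun y => gker d s j (x - y) * f y)
    · simp only [ha, if_pos h]
      exact h.hasSum
    · simp only [ha, if_neg h, tsum_eq_zero_of_not_summable h]
      exact tendsto_const_nhds
  have hlim : Filter.Tendsto (fun S => ∑ x ∈ T, (∑ j, ‖a S x j‖ ^ 2) ^ (q / 2)) Filter.atTop
      (nhds (∑ x ∈ T, (∑ j, ‖fmOp d (gsym d s j) f x‖ ^ 2) ^ (q / 2))) := by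
    refine tendsto_finsetSum _ fun x _ => ?_
    refine Filter.Tendsto.rpow_const ?_ (Or.inr (by linarith))
    refine tendsto_finsetSum _ fun j _ => ?_
    exact (Filter.Tendsto.norm (hat x j)).pow 2
  refine le_of_tendsto hlim (Filter.Eventually.of_forall fun S => ?_)
  calc ∑ x ∈ T, (∑ j, ‖a S x j‖ ^ 2) ^ (q / 2)
      ≤ ∑ x ∈ T, (∑ j, ‖∑ y ∈ S, gker d s j (x - y) * f y‖ ^ 2) ^ (q / 2) := by
        refine Finset.sum_le_sum fun x _ => ?_
        refine Real.rpow_le_rpow (by positivity) (Finset.sum_le_sum fun j _ => ?_) (by linarith)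
        simp only [ha]
        split_ifs
        · exact le_rfl
        · simp
    _ ≤ _ := lattice_ineq d hd s hs q p hq1 hq2 hpq S T f
    _ ≤ _ := by
        refine mul_le_mul_of_nonneg_left (hf.sum_le_tsum S fun y _ => by positivity) (by positivity)

theorem enn_bound (d : ℕ) (hd : 0 < d) (s : ℤ) (hs : s = 1 ∨ s = -1) (q p : ℝ) (hq1 : 1 < q)
    (hq2 : q < 2) (hpq : p * (q - 1) = q) (f : (Fin d → ℤ) → ℂ)
    (hf : ∑' y, (‖f y‖₊ : ℝ≥0∞) ^ q ≠ ∞) :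
    ∑' x, (∑ j, (‖fmOp d (gsym d s j) f x‖₊ : ℝ≥0∞) ^ 2) ^ (q / 2)
      ≤ ENNReal.ofReal ((8 / (q * (q - 1)) + 3 * (5 * p + 1)) ^ q * (d : ℝ) ^ (1 - q / 2))
        * ∑' y, (‖f y‖₊ : ℝ≥0∞) ^ q := by
  have hqq : 0 < q * (q - 1) := mul_pos (by linarith) (by linarith)
  have hp : 0 < p := by
    by_contra h
    push Not at h
    nlinarith
  have e0 : ∀ y, (‖f y‖₊ : ℝ≥0∞) ^ q = ENNReal.ofReal (‖f y‖ ^ q) := by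
    intro y
    rw [← ENNReal.ofReal_rpow_of_nonneg (norm_nonneg _) (by linarith), ofReal_norm]
    rfl
  have hsum : Summable fun y => ‖f y‖ ^ q := by
    simp only [e0] at hf
    have := ENNReal.summable_toReal hf
    refine this.congr fun y => ?_
    rw [ENNReal.toReal_ofReal (by positivity)]
  simp only [e0]
  rw [← ENNReal.ofReal_tsum_of_nonneg (fun y => by positivity) hsum,
    ← ENNReal.ofReal_mul (by positivity), ENNReal.tsum_eq_iSup_sum]
  refine iSup_le fun T => ?_
  have e1 : ∀ x, (∑ j, (‖fmOp d (gsym d s j) f x‖₊ : ℝ≥0∞) ^ 2) ^ (q / 2)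
      = ENNReal.ofReal ((∑ j, ‖fmOp d (gsym d s j) f x‖ ^ 2) ^ (q / 2)) := by
    intro x
    rw [← ENNReal.ofReal_rpow_of_nonneg (by positivity) (by linarith),
      ENNReal.ofReal_sum_of_nonneg (fun j _ => by positivity)]
    congr 1
    refine Finset.sum_congr rfl fun j _ => ?_
    rw [ENNReal.ofReal_pow (norm_nonneg _), ofReal_norm]
    rfl
  simp only [e1]
  rw [← ENNReal.ofReal_sum_of_nonneg (fun x _ => by positivity)]
  exact ENNReal.ofReal_le_ofReal (fin_bound d hd s hs q p hq1 hq2 hpq T f hsum)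

theorem statement17 (q ε : ℝ) (hq1 : 1 < q) (hq2 : q < 2) (hε : 0 < ε) :
    ∃ C : ℝ, 0 < C ∧ ∀ (d : ℕ), 0 < d → ∀ f : (Fin d → ℤ) → ℂ,
      lpZfin d q (fun x => (‖f x‖₊ : ℝ≥0∞)) ≠ ∞ →
      lpZfin d q
          (fun x => (∑ j : Fin d,
            ((‖fmOp d (rieszSym d j) f x‖₊ : ℝ≥0∞) ^ 2
              + (‖fmOp d (rieszStarSym d j) f x‖₊ : ℝ≥0∞) ^ 2)) ^ (1 / 2 : ℝ))
        ≤ ENNReal.ofReal (C * (d : ℝ) ^ (1 / q - 1 / 2 + ε))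
            * lpZfin d q (fun x => (‖f x‖₊ : ℝ≥0∞)) := by
  have hq0 : 0 < q := by linarith
  have hqq : 0 < q * (q - 1) := mul_pos (by linarith) (by linarith)
  obtain ⟨p, hp⟩ : ∃ p, p = q / (q - 1) := ⟨_, rfl⟩
  have hpq : p * (q - 1) = q := by rw [hp]; exact div_mul_cancel₀ _ (by linarith)
  have hp0 : 0 < p := by rw [hp]; exact div_pos hq0 (by linarith)
  set D : ℝ := 8 / (q * (q - 1)) + 3 * (5 * p + 1) with hD
  have hD0 : 0 < D := by positivity
  refine ⟨2 ^ (1 / q) * D, by positivity, fun d hd f hf => ?_⟩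
  have hd1 : (1 : ℝ) ≤ d := by exact_mod_cast hd
  have hd0 : (0 : ℝ) < d := by linarith
  have hf' : ∑' y, (‖f y‖₊ : ℝ≥0∞) ^ q ≠ ∞ := by
    intro h
    apply hf
    simp only [lpZfin]
    rw [h]
    exact ENNReal.top_rpow_of_pos (by positivity)
  have r1 : ∀ j, rieszSym d j = gsym d 1 j := by
    intro j; funext ξ; simp [rieszSym, gsym]
  have r2 : ∀ j, rieszStarSym d j = gsym d (-1) j := by
    intro j; funext ξ; simp [rieszStarSym, gsym]
  have b1 := enn_bound d hd 1 (Or.inl rfl) q p hq1 hq2 hpq f hf'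
  have b2 := enn_bound d hd (-1) (Or.inr rfl) q p hq1 hq2 hpq f hf'
  rw [← hD] at b1 b2
  simp only [r1, r2, lpZfin]
  have hmain : ∑' x, ((∑ j : Fin d,
            ((‖fmOp d (gsym d 1 j) f x‖₊ : ℝ≥0∞) ^ 2
              + (‖fmOp d (gsym d (-1) j) f x‖₊ : ℝ≥0∞) ^ 2)) ^ (1 / 2 : ℝ)) ^ q
      ≤ ENNReal.ofReal (2 * (D ^ q * (d : ℝ) ^ (1 - q / 2))) * ∑' y, (‖f y‖₊ : ℝ≥0∞) ^ q := by
    rw [ENNReal.ofReal_mul (by norm_num), mul_assoc, ENNReal.ofReal_ofNat, two_mul]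
    refine le_trans ?_ (add_le_add b1 b2)
    rw [← ENNReal.tsum_add]
    refine ENNReal.tsum_le_tsum fun x => ?_
    rw [← ENNReal.rpow_mul, Finset.sum_add_distrib, one_div_mul_eq_div]
    exact ENNReal.rpow_add_le_add_rpow _ _ (by linarith) (by linarith)
  have h3 := ENNReal.rpow_le_rpow hmain (by positivity : 0 ≤ 1 / q)
  refine h3.trans ?_
  rw [ENNReal.mul_rpow_of_nonneg _ _ (by positivity)]
  refine mul_le_mul_left ?_ _
  rw [ENNReal.ofReal_rpow_of_nonneg (by positivity) (by positivity)]
  refine ENNReal.ofReal_le_ofReal ?_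
  rw [Real.mul_rpow (by norm_num) (by positivity), Real.mul_rpow (by positivity) (by positivity),
    ← Real.rpow_mul hD0.le, ← Real.rpow_mul hd0.le, mul_one_div_cancel hq0.ne', Real.rpow_one,
    ← mul_assoc]
  refine mul_le_mul_of_nonneg_left ?_ (by positivity)
  refine Real.rpow_le_rpow_of_exponent_le hd1 ?_
  have : (1 - q / 2) * (1 / q) = 1 / q - 1 / 2 := by field_simp
  linarith
end

section
/- For every q ∈ (1,2) there exists a constant C_q > 0 such that for every d ∈ ℕ one has sup{ ‖ ( Σ_{j=1}^d |𝓡_j f|² )^{1/2} ‖_{ℓ^q(ℤ^d)} / ‖f‖_{ℓ^q(ℤ^d)} : f ∈ ℓ^q(ℤ^d), 0 < ‖f‖_{ℓ^q} ≤ 1 } ≥ C_q · d^{1/q − 1/2}. In particular, the vector-valued Riesz transform bound on ℓ^q(ℤ^d) for q ∈ (1,2) cannot hold with a constant independent of the dimension. -/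
open MeasureTheory ENNReal

lemma aux_int (d : ℕ) (j : Fin d) :
    ∫ ξ in Set.Icc (fun _ : Fin d => -(1 / 2 : ℝ)) (fun _ => (1 / 2 : ℝ)),
      Real.sin (Real.pi * ξ j) ^ 2 = 1 / 2 := by
  have h1 : (volume : Measure (Fin d → ℝ)).restrict
      (Set.Icc (fun _ : Fin d => -(1 / 2 : ℝ)) (fun _ => (1 / 2 : ℝ)))
      = Measure.pi (fun _ => (volume : Measure ℝ).restrict (Set.Icc (-(1/2)) (1/2))) := by
    rw [← Set.pi_univ_Icc, volume_pi, Measure.restrict_pi_pi]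
  have : IsProbabilityMeasure ((volume : Measure ℝ).restrict (Set.Icc (-(1/2)) (1/2))) := by
    constructor
    simp
    norm_num
  rw [h1]
  have h2 := integral_comp_eval (μ := fun _ : Fin d => (volume : Measure ℝ).restrict (Set.Icc (-(1/2)) (1/2)))
    (i := j) (f := fun t : ℝ => Real.sin (Real.pi * t) ^ 2)
    (by apply Continuous.aestronglyMeasurable; fun_prop)
  rw [h2, integral_Icc_eq_integral_Ioc, ← intervalIntegral.integral_of_le (by norm_num),
    intervalIntegral.integral_comp_mul_left (fun t => Real.sin t ^ 2) Real.pi_ne_zero, integral_sin_sq]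
  have a1 : Real.pi * -(1/2) = -(Real.pi/2) := by ring
  have a2 : Real.pi * (1/2) = Real.pi/2 := by ring
  rw [a1, a2, Real.sin_neg, Real.cos_neg, Real.cos_pi_div_two]
  have := Real.pi_ne_zero
  simp
  field_simp

lemma aux_sin_le (d : ℕ) (j : Fin d) (ξ : Fin d → ℝ) :
    |Real.sin (Real.pi * ξ j)| ≤ sinNorm d ξ := by
  rw [← Real.sqrt_sq_eq_abs]
  exact Real.sqrt_le_sqrt (Finset.single_le_sum (f := fun k => Real.sin (Real.pi * ξ k) ^ 2)
    (fun k _ => sq_nonneg _) (Finset.mem_univ j))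

lemma aux_le (d : ℕ) (ξ : Fin d → ℝ) : sinNorm d ξ ≤ Real.sqrt d := by
  refine Real.sqrt_le_sqrt ?_
  calc _ ≤ ∑ k : Fin d, (1:ℝ) := Finset.sum_le_sum (fun k _ => Real.sin_sq_le_one _)
    _ = d := by simp

lemma aux_expr (t : ℝ) : (1 - Complex.exp (-(2 * Real.pi * Complex.I) * (t : ℂ))) *
      Complex.exp (-(2 * Real.pi * Complex.I) * (-(t:ℂ)))
    = ((-(2 * Real.sin (Real.pi * t) ^ 2) : ℝ) : ℂ)
      + ((2 * Real.sin (Real.pi * t) * Real.cos (Real.pi * t) : ℝ) : ℂ) * Complex.I := by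
  have h : -(2 * Real.pi * Complex.I) * (-(t:ℂ)) = ((2 * (Real.pi * t) : ℝ) : ℂ) * Complex.I := by
    push_cast; ring
  rw [sub_mul, ← Complex.exp_add, one_mul]
  have h' : -(2 * Real.pi * Complex.I) * (t:ℂ) + -(2 * Real.pi * Complex.I) * (-(t:ℂ)) = 0 := by ring
  rw [h', h, Complex.exp_zero, Complex.exp_mul_I, ← Complex.ofReal_cos, ← Complex.ofReal_sin,
    Real.cos_two_mul', Real.sin_two_mul]
  have := Real.sin_sq_add_cos_sq (Real.pi * t)
  have e : Real.cos (Real.pi * t) ^ 2 = 1 - Real.sin (Real.pi * t) ^ 2 := by linarith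
  rw [e]
  push_cast
  ring

lemma aux_sum (d : ℕ) (j : Fin d) (ξ : Fin d → ℝ) :
    ∑ k, ((((-Pi.single j (1:ℤ) : Fin d → ℤ) - 0) k : ℤ) : ℂ) * (ξ k : ℂ) = -(ξ j : ℂ) := by
  rw [Finset.sum_eq_single j]
  · simp
  · intro b _ hb
    simp [Pi.single_eq_of_ne hb]
  · simp

lemma aux_fm (d : ℕ) (hd : 0 < d) (j : Fin d) :
    1 / (2 * Real.sqrt d) ≤
      ‖fmOp d (rieszSym d j) (Pi.single 0 1) (-Pi.single j (1:ℤ))‖ := by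
  unfold fmOp
  rw [tsum_eq_single 0 (by intro b hb; simp [Pi.single_eq_of_ne hb])]
  rw [Pi.single_eq_same, mul_one]
  set F : (Fin d → ℝ) → ℂ := fun ξ => rieszSym d j ξ * Complex.exp (-(2 * Real.pi * Complex.I) *
    ∑ k, ((((-Pi.single j (1:ℤ) : Fin d → ℤ) - 0) k : ℤ) : ℂ) * (ξ k : ℂ)) with hF
  have hF' : ∀ ξ, F ξ = (((-(2 * Real.sin (Real.pi * ξ j) ^ 2)) / (2 * sinNorm d ξ) : ℝ) : ℂ)
      + ((2 * Real.sin (Real.pi * ξ j) * Real.cos (Real.pi * ξ j) / (2 * sinNorm d ξ) : ℝ) : ℂ)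
        * Complex.I := by
    intro ξ
    simp only [hF]
    rw [aux_sum, rieszSym, div_mul_eq_mul_div, aux_expr]
    push_cast
    ring
  have hs : Measurable (sinNorm d) := by unfold sinNorm; fun_prop
  have hm : Measurable F := by
    have : F = fun ξ => (((-(2 * Real.sin (Real.pi * ξ j) ^ 2)) / (2 * sinNorm d ξ) : ℝ) : ℂ)
      + ((2 * Real.sin (Real.pi * ξ j) * Real.cos (Real.pi * ξ j) / (2 * sinNorm d ξ) : ℝ) : ℂ)
        * Complex.I := funext hF'
    rw [this]
    fun_prop
  have hfin : volume (Set.Icc (fun _ : Fin d => -(1 / 2 : ℝ)) (fun _ => (1 / 2 : ℝ))) ≠ ⊤ :=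
    isCompact_Icc.measure_lt_top.ne
  have hb : ∀ ξ, ‖F ξ‖ ≤ 2 := by
    intro ξ
    have h0 := aux_sin_le d j ξ
    have hdiv : |Real.sin (Real.pi * ξ j)| / sinNorm d ξ ≤ 1 :=
      div_le_one_of_le₀ h0 (Real.sqrt_nonneg _)
    have hn : |sinNorm d ξ| = sinNorm d ξ := abs_of_nonneg (Real.sqrt_nonneg _)
    have hc := Real.abs_cos_le_one (Real.pi * ξ j)
    have hsn := Real.abs_sin_le_one (Real.pi * ξ j)
    have hp : 0 ≤ |Real.sin (Real.pi * ξ j)| / sinNorm d ξ :=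
      div_nonneg (abs_nonneg _) (Real.sqrt_nonneg _)
    rw [hF']
    refine (norm_add_le _ _).trans ?_
    rw [norm_mul, Complex.norm_I, mul_one, Complex.norm_real, Complex.norm_real,
      Real.norm_eq_abs, Real.norm_eq_abs]
    have e1 : |(-(2 * Real.sin (Real.pi * ξ j) ^ 2)) / (2 * sinNorm d ξ)|
        = |Real.sin (Real.pi * ξ j)| / sinNorm d ξ * |Real.sin (Real.pi * ξ j)| := by
      rw [abs_div, abs_neg, abs_mul, abs_mul, abs_pow, hn, abs_two, mul_div_mul_left _ _ two_ne_zero]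
      ring
    have e2 : |2 * Real.sin (Real.pi * ξ j) * Real.cos (Real.pi * ξ j) / (2 * sinNorm d ξ)|
        = |Real.sin (Real.pi * ξ j)| / sinNorm d ξ * |Real.cos (Real.pi * ξ j)| := by
      rw [abs_div, abs_mul, abs_mul, abs_mul, hn, abs_two, mul_assoc, mul_div_mul_left _ _ two_ne_zero]
      ring
    rw [e1, e2]
    nlinarith [abs_nonneg (Real.sin (Real.pi * ξ j)), abs_nonneg (Real.cos (Real.pi * ξ j))]
  have hI : IntegrableOn F (Set.Icc (fun _ : Fin d => -(1 / 2 : ℝ)) (fun _ => (1 / 2 : ℝ))) :=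
    Measure.integrableOn_of_bounded hfin hm.aestronglyMeasurable (M := 2)
      (Filter.Eventually.of_forall hb)
  refine le_trans ?_ (Complex.abs_re_le_norm _)
  have hre := integral_re hI
  simp only [RCLike.re_eq_complex_re] at hre
  rw [← hre]
  have hre' : ∀ ξ, (F ξ).re = -(Real.sin (Real.pi * ξ j) ^ 2 / sinNorm d ξ) := by
    intro ξ
    rw [hF', Complex.add_re, Complex.ofReal_re, Complex.re_ofReal_mul, Complex.I_re, mul_zero,
      add_zero, neg_div, mul_div_mul_left _ _ two_ne_zero]
  have hIre := hI.re.neg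
  have hd' : 0 < Real.sqrt d := Real.sqrt_pos.2 (by exact_mod_cast hd)
  refine le_trans ?_ (neg_le_abs _)
  rw [← integral_neg]
  calc 1 / (2 * Real.sqrt d) = ∫ ξ in Set.Icc (fun _ : Fin d => -(1 / 2 : ℝ)) (fun _ => (1 / 2 : ℝ)),
      Real.sin (Real.pi * ξ j) ^ 2 / Real.sqrt d := by
        rw [integral_div, aux_int]; field_simp
    _ ≤ _ := by
      refine integral_mono ?_ hIre ?_
      · refine Continuous.integrableOn_Icc ?_
        fun_prop
      · intro ξ
        simp only [hre', neg_neg]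
        rcases eq_or_lt_of_le (show 0 ≤ sinNorm d ξ from Real.sqrt_nonneg _) with h | h
        · have := aux_sin_le d j ξ
          rw [← h] at this
          have : Real.sin (Real.pi * ξ j) = 0 := abs_nonpos_iff.1 this
          simp [this]
        · exact div_le_div_of_nonneg_left (sq_nonneg _) h (aux_le d ξ)

lemma aux_one (d : ℕ) (q : ℝ) (hq : 0 < q) :
    lpZfin d q (fun x => (‖(Pi.single 0 1 : (Fin d → ℤ) → ℂ) x‖₊ : ℝ≥0∞)) = 1 := by
  unfold lpZfin
  rw [tsum_eq_single 0]
  · simp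
  · intro b hb
    simp [Pi.single_eq_of_ne hb, hq]

/-- sharpness of the `d^{1/q−1/2}` growth for the vector-valued Riesz
transform bound on ℓ^q(ℤ^d), `q ∈ (1,2)` (Proposition A.2, (A.3)): the best constant is
at least `C_q d^{1/q − 1/2}`, so no dimension-free bound can hold. -/
theorem statement18 (q : ℝ) (hq1 : 1 < q) (hq2 : q < 2) :
    ∃ C : ℝ, 0 < C ∧ ∀ d : ℕ, 0 < d →
      ENNReal.ofReal (C * (d : ℝ) ^ (1 / q - 1 / 2)) ≤
        ⨆ f : {f : (Fin d → ℤ) → ℂ //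
            lpZfin d q (fun x => (‖f x‖₊ : ℝ≥0∞)) ≠ 0 ∧
            lpZfin d q (fun x => (‖f x‖₊ : ℝ≥0∞)) ≤ 1},
          lpZfin d q
              (fun x => (∑ j : Fin d,
                (‖fmOp d (rieszSym d j) (↑f) x‖₊ : ℝ≥0∞) ^ 2) ^ (1 / 2 : ℝ))
            / lpZfin d q (fun x => (‖(↑f : (Fin d → ℤ) → ℂ) x‖₊ : ℝ≥0∞)) := by
  have hq : 0 < q := by linarith
  refine ⟨1/2, by norm_num, fun d hd => ?_⟩
  have h1 := aux_one d q hq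
  refine le_trans ?_ (le_iSup _ ⟨Pi.single 0 1, by rw [h1]; simp, by rw [h1]⟩)
  simp only
  rw [h1, div_one]
  unfold lpZfin
  have hdr : (0:ℝ) < d := by exact_mod_cast hd
  have hinj : Function.Injective (fun j : Fin d => (-Pi.single j (1:ℤ) : Fin d → ℤ)) := by
    intro a b hab
    by_contra hne
    have := congrFun (neg_injective hab) a
    simp [Pi.single_eq_of_ne hne] at this
  have key : (d : ℝ≥0∞) * ENNReal.ofReal (1 / (2 * Real.sqrt d)) ^ q ≤
      ∑' x, ((∑ j : Fin d,
        (‖fmOp d (rieszSym d j) (Pi.single 0 1) x‖₊ : ℝ≥0∞) ^ 2) ^ (1 / 2 : ℝ)) ^ q := by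
    refine le_trans ?_ (ENNReal.tsum_comp_le_tsum_of_injective hinj _)
    rw [tsum_fintype]
    calc _ = ∑ j : Fin d, ENNReal.ofReal (1 / (2 * Real.sqrt d)) ^ q := by simp
      _ ≤ _ := by
        refine Finset.sum_le_sum fun j _ => ?_
        refine ENNReal.rpow_le_rpow ?_ hq.le
        have h2 : ENNReal.ofReal (1 / (2 * Real.sqrt d)) ≤
            (‖fmOp d (rieszSym d j) (Pi.single 0 1) (-Pi.single j (1:ℤ))‖₊ : ℝ≥0∞) := by
          have := ENNReal.ofReal_le_ofReal (aux_fm d hd j)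
          rwa [ofReal_norm] at this
        refine h2.trans ?_
        have h3 := ENNReal.rpow_le_rpow (Finset.single_le_sum
          (f := fun i => (‖fmOp d (rieszSym d i) (Pi.single 0 1) (-Pi.single j (1:ℤ))‖₊ : ℝ≥0∞) ^ 2)
          (fun i _ => zero_le) (Finset.mem_univ j)) (by norm_num : (0:ℝ) ≤ 1/2)
        refine le_trans (le_of_eq ?_) h3
        rw [← ENNReal.rpow_natCast, ← ENNReal.rpow_mul]
        norm_num
  refine le_trans (le_of_eq ?_) (ENNReal.rpow_le_rpow key (by positivity : 0 ≤ 1 / q))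
  rw [ENNReal.mul_rpow_of_nonneg _ _ (by positivity), ← ENNReal.rpow_mul, mul_one_div_cancel hq.ne',
    ENNReal.rpow_one, ← ENNReal.ofReal_natCast, ENNReal.ofReal_rpow_of_pos hdr,
    ← ENNReal.ofReal_mul (by positivity)]
  congr 1
  rw [Real.rpow_sub hdr, Real.sqrt_eq_rpow]
  field_simp
end

section
/- For every q ∈ [1, ∞) and every f ∈ ℓ^q(ℤ^d) one has ‖ 𝓛^{1/2} f ‖_{ℓ^q(ℤ^d)} ≤ 2 · ‖ 𝓛 f ‖_{ℓ^q(ℤ^d)}^{1/2} · ‖ f ‖_{ℓ^q(ℤ^d)}^{1/2}, where 𝓛 is the discrete Laplacian on ℤ^d and 𝓛^{1/2} is its square root, the Fourier multiplier operator with symbol |ξ|_sin. -/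
open MeasureTheory ENNReal

/-- The discrete Laplacian `𝓛 = (1/4)Σ_k Δ_k^*Δ_k`, i.e.
`𝓛f(x) = (1/4)Σ_k (2f(x) − f(x+e_k) − f(x−e_k))`. -/
noncomputable def discLap (d : ℕ) (f : (Fin d → ℤ) → ℂ) (x : Fin d → ℤ) : ℂ :=
  (1 / 4 : ℂ) * ∑ k : Fin d,
    (2 * f x - f (x + Pi.single k 1) - f (x - Pi.single k 1))

/-- The square root `𝓛^{1/2}` of the discrete Laplacian: the Fourier multiplier operator
with symbol `|ξ|_sin`. -/
noncomputable def discLapSqrt (d : ℕ) (f : (Fin d → ℤ) → ℂ) : (Fin d → ℤ) → ℂ :=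
  fmOp d (fun ξ => (sinNorm d ξ : ℂ)) f

noncomputable def uu (n : ℕ) : ℝ := (n.centralBinom : ℝ) / 4 ^ n
noncomputable def cc (n : ℕ) : ℝ := (catalan n : ℝ) / (2 * 4 ^ n)

lemma uu_zero : uu 0 = 1 := by simp [uu]

lemma uu_pos (n : ℕ) : 0 < uu n := by
  have := Nat.centralBinom_pos n
  unfold uu; positivity

lemma uu_succ (n : ℕ) : (2 * n + 2) * uu (n + 1) = (2 * n + 1) * uu n := by
  have h := Nat.succ_mul_centralBinom_succ n
  have h' : ((n : ℝ) + 1) * ((n + 1).centralBinom : ℝ) = 2 * (2 * n + 1) * (n.centralBinom : ℝ) := by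
    exact_mod_cast h
  unfold uu
  rw [pow_succ]
  field_simp
  linarith

lemma cc_nonneg (n : ℕ) : 0 ≤ cc n := by unfold cc; positivity

lemma cc_mul (n : ℕ) : cc n * (n + 1) = uu n / 2 := by
  have h' : ((n : ℝ) + 1) * (catalan n : ℝ) = n.centralBinom := by
    exact_mod_cast succ_mul_catalan_eq_centralBinom n
  unfold uu cc
  rw [← h']
  field_simp

lemma cc_eq (n : ℕ) : cc n = uu n - uu (n + 1) := by
  have h1 := cc_mul n
  have h2 := uu_succ n
  have h3 : (0 : ℝ) < n + 1 := by positivity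
  apply mul_right_cancel₀ h3.ne'
  linarith

lemma uu_sq (n : ℕ) : uu n ^ 2 * (2 * n + 1) ≤ 1 := by
  induction n with
  | zero => simp [uu_zero]
  | succ n ih =>
    have h2 := uu_succ n
    have h3 : (0 : ℝ) < (2 * n + 2) ^ 2 := by positivity
    have h4 : (2 * n + 2) ^ 2 * (uu (n + 1) ^ 2 * (2 * ((n + 1 : ℕ) : ℝ) + 1))
        ≤ (2 * n + 2) ^ 2 * 1 := by
      push_cast
      calc _ = ((2 * n + 2) * uu (n + 1)) ^ 2 * (2 * n + 3) := by ring
        _ = (uu n ^ 2 * (2 * n + 1)) * ((2 * n + 1) * (2 * n + 3)) := by rw [h2]; ring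
        _ ≤ 1 * ((2 * n + 1) * (2 * n + 3)) := by gcongr
        _ ≤ _ := by nlinarith
    exact le_of_mul_le_mul_left h4 h3

lemma sum_cc (n : ℕ) : ∑ i ∈ Finset.range n, cc i = 1 - uu n := by
  simp_rw [cc_eq, Finset.sum_range_sub', uu_zero]

lemma sum_cc_mul (n : ℕ) : ∑ i ∈ Finset.range n, cc i * (i + 1) = n * uu n := by
  induction n with
  | zero => simp
  | succ n ih =>
    rw [Finset.sum_range_succ, ih, cc_mul]
    have := uu_succ n
    push_cast
    linarith

lemma uu_tendsto : Filter.Tendsto uu Filter.atTop (nhds 0) := by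
  have h : Filter.Tendsto (fun n => uu n ^ 2) Filter.atTop (nhds 0) := by
    refine squeeze_zero (fun n => sq_nonneg _) (g := fun n : ℕ => 1 / ((n : ℝ) + 1)) (fun n => ?_)
      tendsto_one_div_add_atTop_nhds_zero_nat
    rw [le_div_iff₀ (by positivity)]
    refine le_trans ?_ (uu_sq n)
    gcongr
    have : (0 : ℝ) ≤ n := by positivity
    linarith
  have h2 := h.sqrt
  simp only [Real.sqrt_zero] at h2
  refine h2.congr fun n => Real.sqrt_sq (uu_pos n).le

lemma hasSum_cc : HasSum cc 1 := by
  rw [hasSum_iff_tendsto_nat_of_nonneg cc_nonneg]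
  simp_rw [sum_cc]
  simpa using uu_tendsto.const_sub 1

/-- power series for the square root on the closed unit interval -/
lemma hasSum_sqrt (z : ℝ) (hz : |z| ≤ 1) :
    HasSum (fun n => cc n * z ^ (n + 1)) (1 - Real.sqrt (1 - z)) := by
  have hb : ∀ n, ‖cc n * z ^ (n + 1)‖ ≤ cc n := fun n => by
    rw [norm_mul, norm_pow, Real.norm_of_nonneg (cc_nonneg n)]
    exact mul_le_of_le_one_right (cc_nonneg n) (pow_le_one₀ (norm_nonneg _) hz)
  have hs : Summable (fun n => ‖cc n * z ^ (n + 1)‖) :=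
    Summable.of_nonneg_of_le (fun _ => norm_nonneg _) hb hasSum_cc.summable
  have hs' := hs.of_norm
  set G := ∑' n, cc n * z ^ (n + 1) with hG
  have hle : G ≤ 1 := by
    rw [hG, ← hasSum_cc.tsum_eq]
    exact hs'.tsum_le_tsum (fun n => (le_abs_self _).trans (hb n)) hasSum_cc.summable
  have hGG : G * G = 2 * G - z := by
    have h1 := tsum_mul_tsum_eq_tsum_sum_antidiagonal_of_summable_norm hs hs
    have h2 : ∀ n, ∑ kl ∈ Finset.HasAntidiagonal.antidiagonal n, cc kl.1 * z ^ (kl.1 + 1) * (cc kl.2 * z ^ (kl.2 + 1))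
        = 2 * (cc (n + 1) * z ^ (n + 2)) := by
      intro n
      have h3 : cc (n + 1) = (∑ kl ∈ Finset.HasAntidiagonal.antidiagonal n, (catalan kl.1 : ℝ) * catalan kl.2) / (2 * 4 ^ (n + 1)) := by
        unfold cc; rw [catalan_succ']; push_cast; rfl
      rw [h3, Finset.sum_div, Finset.sum_mul, Finset.mul_sum]
      refine Finset.sum_congr rfl fun kl hkl => ?_
      rw [Finset.HasAntidiagonal.mem_antidiagonal] at hkl
      subst hkl
      unfold cc
      field_simp
      ring
    simp_rw [h2] at h1
    rw [← hG, tsum_mul_left] at h1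
    rw [h1]
    have h4 := hs'.tsum_eq_zero_add
    rw [← hG] at h4
    have : cc 0 = 1 / 2 := by simp [cc]
    simp only [this] at h4
    rw [h4]; ring
  have : Real.sqrt (1 - z) = 1 - G := by
    rw [show 1 - z = (1 - G) ^ 2 by linear_combination -hGG]
    exact Real.sqrt_sq (by linarith)
  rw [this]
  simpa using hs'.hasSum

lemma tsum_bound (a b : ℝ) (ha : 0 ≤ a) (hb : 0 ≤ b) (w : ℕ → ℝ) (hw0 : ∀ n, 0 ≤ w n)
    (hw1 : ∀ n, w n ≤ 2 * a) (hw2 : ∀ n, w n ≤ (n + 1) * b) :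
    ∑' n, cc n * w n ≤ 2 * Real.sqrt (a * b) := by
  rcases hb.eq_or_lt with rfl | hb
  · have : ∀ n, w n = 0 := fun n => le_antisymm (by simpa using hw2 n) (hw0 n)
    simp [this]
  set r := 2 * a / b with hr
  have hr0 : 0 ≤ r := by positivity
  have har : 2 * a = r * b := by rw [hr]; field_simp
  set N := ⌊r⌋₊ with hN
  have hN1 : (N : ℝ) ≤ r := Nat.floor_le hr0
  have hN2 : r < N + 1 := Nat.lt_floor_add_one r
  have key : (N * b + 2 * a) * uu N ≤ 2 * Real.sqrt (a * b) := by
    have h1 : 2 * Real.sqrt (a * b) = Real.sqrt (4 * (a * b)) := by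
      rw [Real.sqrt_mul (by norm_num) (a * b), show (4 : ℝ) = 2 ^ 2 by norm_num,
        Real.sqrt_sq (by norm_num)]
    rw [h1]
    apply Real.le_sqrt_of_sq_le
    have h2 : 4 * (a * b) = b ^ 2 * (2 * r) := by linear_combination 2 * b * har
    rw [h2, har]
    have h3 := uu_sq N
    have hN0 : (0 : ℝ) ≤ N := by positivity
    have h4 : (N + r) ^ 2 ≤ 2 * r * (2 * N + 1) := by nlinarith
    calc _ = b ^ 2 * (uu N ^ 2 * (N + r) ^ 2) := by ring
      _ ≤ b ^ 2 * (uu N ^ 2 * (2 * r * (2 * N + 1))) := by gcongr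
      _ = b ^ 2 * (2 * r) * (uu N ^ 2 * (2 * N + 1)) := by ring
      _ ≤ b ^ 2 * (2 * r) * 1 := by gcongr
      _ = _ := by ring
  refine le_trans ?_ key
  apply Real.tsum_le_of_sum_range_le (fun n => mul_nonneg (cc_nonneg n) (hw0 n))
  intro M
  calc ∑ i ∈ Finset.range M, cc i * w i
      ≤ ∑ i ∈ Finset.range (N + M), cc i * w i :=
        Finset.sum_le_sum_of_subset_of_nonneg (by simp)
          (fun i _ _ => mul_nonneg (cc_nonneg i) (hw0 i))
    _ = ∑ i ∈ Finset.range N, cc i * w i + ∑ i ∈ Finset.range M, cc (N + i) * w (N + i) :=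
        Finset.sum_range_add _ _ _
    _ ≤ ∑ i ∈ Finset.range N, cc i * ((i + 1) * b) + ∑ i ∈ Finset.range M, cc (N + i) * (2 * a) := by
        gcongr with i hi i hi
        · exact cc_nonneg _
        · exact hw2 i
        · exact cc_nonneg _
        · exact hw1 _
    _ = N * b * uu N + (uu N - uu (N + M)) * (2 * a) := by
        rw [← Finset.sum_mul]
        have h1 := Finset.sum_range_add cc N M
        rw [sum_cc, sum_cc] at h1
        simp_rw [← mul_assoc]
        rw [← Finset.sum_mul, sum_cc_mul]
        linear_combination (- 2 * a) * h1
    _ ≤ _ := by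
        have := (uu_pos (N + M)).le
        nlinarith [mul_nonneg this ha]

lemma op_bound {E : Type*} [NormedAddCommGroup E] [NormedSpace ℂ E] [CompleteSpace E]
    (P : E →L[ℂ] E) (hP : ∀ g, ‖P g‖ ≤ ‖g‖) (f : E) :
    ∃ T : E →L[ℂ] E, (∀ g, HasSum (fun n => (cc n : ℂ) • (g - (P ^ (n + 1)) g)) (T g)) ∧
      ‖T f‖ ≤ 2 * Real.sqrt (‖f‖ * ‖f - P f‖) := by
  have hn : ‖P‖ ≤ 1 := P.opNorm_le_bound zero_le_one (by simpa using hP)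
  have hPn : ∀ n (g : E), ‖(P ^ n) g‖ ≤ ‖g‖ := by
    intro n g
    induction n with
    | zero => simp
    | succ n ih => rw [pow_succ']; exact (hP _).trans ih
  have hs : Summable (fun n => (cc n : ℂ) • ((1 : E →L[ℂ] E) - P ^ (n + 1))) := by
    apply Summable.of_norm_bounded (hasSum_cc.summable.mul_right 2)
    intro n
    rw [norm_smul, Complex.norm_real, Real.norm_of_nonneg (cc_nonneg n)]
    gcongr
    · exact cc_nonneg n
    refine ContinuousLinearMap.opNorm_le_bound _ (by norm_num) fun g => ?_
    have := norm_sub_le g ((P ^ (n + 1)) g)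
    have := hPn (n + 1) g
    simp only [sub_apply, one_apply_eq_self]
    linarith
  have hT : ∀ g, HasSum (fun n => (cc n : ℂ) • (g - (P ^ (n + 1)) g))
      ((∑' n, (cc n : ℂ) • ((1 : E →L[ℂ] E) - P ^ (n + 1))) g) := fun g => by
    have := (ContinuousLinearMap.apply ℂ E g).hasSum hs.hasSum
    simpa using this
  refine ⟨_, hT, ?_⟩
  rw [← (hT f).tsum_eq]
  have h2 : ∀ n, ‖f - (P ^ (n + 1)) f‖ ≤ 2 * ‖f‖ := fun n => by
    have := norm_sub_le f ((P ^ (n + 1)) f)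
    have := hPn (n + 1) f
    linarith
  have h3 : ∀ n : ℕ, ‖f - (P ^ n) f‖ ≤ n * ‖f - P f‖ := fun n => by
    induction n with
    | zero => simp
    | succ n ih =>
      have : f - (P ^ (n + 1)) f = (f - (P ^ n) f) + (P ^ n) (f - P f) := by
        rw [pow_succ]; simp
      rw [this]
      have h4 := norm_add_le (f - (P ^ n) f) ((P ^ n) (f - P f))
      have h5 := hPn n (f - P f)
      rw [Nat.cast_succ]; linarith
  have hnorm : ∀ n, ‖(cc n : ℂ) • (f - (P ^ (n + 1)) f)‖ = cc n * ‖f - (P ^ (n + 1)) f‖ := fun n => by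
    rw [norm_smul, Complex.norm_real, Real.norm_of_nonneg (cc_nonneg n)]
  have hsn : Summable fun n => ‖(cc n : ℂ) • (f - (P ^ (n + 1)) f)‖ := by
    apply Summable.of_nonneg_of_le (fun _ => norm_nonneg _) _ (hasSum_cc.summable.mul_right (2 * ‖f‖))
    intro n
    rw [hnorm]
    exact mul_le_mul_of_nonneg_left (h2 n) (cc_nonneg n)
  refine (norm_tsum_le_tsum_norm hsn).trans ?_
  simp_rw [hnorm]
  exact tsum_bound _ _ (norm_nonneg _) (norm_nonneg _) _ (fun _ => norm_nonneg _) h2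
    (fun n => by simpa using h3 (n + 1))

noncomputable abbrev EE (d : ℕ) (p : ℝ≥0∞) := lp (fun _ : Fin d → ℤ => ℂ) p

lemma memlp_shift {d : ℕ} {p : ℝ≥0∞} (hp : 0 < p.toReal) (a : Fin d → ℤ) (f : (Fin d → ℤ) → ℂ)
    (hf : Memℓp f p) : Memℓp (fun x => f (x + a)) p := by
  rw [memℓp_gen_iff hp] at hf ⊢
  have := hf.comp_injective (Equiv.addRight a).injective
  exact this

noncomputable def shiftL {d : ℕ} {p : ℝ≥0∞} [Fact (1 ≤ p)] (hp : 0 < p.toReal) (a : Fin d → ℤ) :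
    EE d p →ₗᵢ[ℂ] EE d p where
  toFun f := ⟨fun x => f (x + a), memlp_shift hp a f (lp.memℓp f)⟩
  map_add' f g := by ext x; rfl
  map_smul' c f := by ext x; rfl
  norm_map' f := by
    rw [lp.norm_eq_tsum_rpow hp, lp.norm_eq_tsum_rpow hp]
    congr 1
    exact (Equiv.addRight a).tsum_eq (fun x => ‖f x‖ ^ p.toReal)

lemma shiftL_apply {d : ℕ} {p : ℝ≥0∞} [Fact (1 ≤ p)] (hp : 0 < p.toReal) (a : Fin d → ℤ)
    (f : EE d p) (x : Fin d → ℤ) : shiftL hp a f x = f (x + a) := rfl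

noncomputable def PP {d : ℕ} {p : ℝ≥0∞} [Fact (1 ≤ p)] (hp : 0 < p.toReal) : EE d p →L[ℂ] EE d p :=
  (1 / (2 * d) : ℂ) • ∑ k : Fin d, ((shiftL hp (Pi.single k 1)).toContinuousLinearMap
    + (shiftL hp (-Pi.single k 1)).toContinuousLinearMap)

lemma PP_apply {d : ℕ} {p : ℝ≥0∞} [Fact (1 ≤ p)] (hp : 0 < p.toReal) (f : EE d p)
    (x : Fin d → ℤ) : PP hp f x = (1 / (2 * d) : ℂ) *
      ∑ k : Fin d, (f (x + Pi.single k 1) + f (x - Pi.single k 1)) := by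
  have h2 : PP hp f = (1 / (2 * d) : ℂ) •
      ∑ k : Fin d, (shiftL hp (Pi.single k 1) f + shiftL hp (-Pi.single k 1) f) := by
    simp [PP]
  rw [h2, lp.coeFn_smul, Pi.smul_apply, lp.coeFn_sum, Finset.sum_apply, smul_eq_mul]
  congr 1

lemma PP_norm {d : ℕ} (hd : 0 < d) {p : ℝ≥0∞} [Fact (1 ≤ p)] (hp : 0 < p.toReal) (f : EE d p) :
    ‖PP hp f‖ ≤ ‖f‖ := by
  have h : ‖∑ k : Fin d, (shiftL hp (Pi.single k 1) f + shiftL hp (-Pi.single k 1) f)‖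
      ≤ ∑ k : Fin d, 2 * ‖f‖ := by
    refine (norm_sum_le _ _).trans (Finset.sum_le_sum fun k _ => ?_)
    refine (norm_add_le _ _).trans ?_
    rw [LinearIsometry.norm_map, LinearIsometry.norm_map]; linarith
  have hd' : (0 : ℝ) < d := by exact_mod_cast hd
  have h2 : PP hp f = (1 / (2 * d) : ℂ) •
      ∑ k : Fin d, (shiftL hp (Pi.single k 1) f + shiftL hp (-Pi.single k 1) f) := by
    simp [PP]
  rw [h2, norm_smul]
  simp only [Finset.sum_const, Finset.card_univ, Fintype.card_fin, nsmul_eq_mul] at h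
  have h3 : ‖(1 / (2 * d) : ℂ)‖ = 1 / (2 * d) := by simp
  rw [h3, one_div, inv_mul_le_iff₀ (by positivity)]
  linarith

noncomputable def ch {d : ℕ} (z : Fin d → ℤ) (ξ : Fin d → ℝ) : ℂ :=
  Complex.exp (-(2 * Real.pi * Complex.I) * ∑ k, ((z k : ℤ) : ℂ) * (ξ k : ℂ))

noncomputable def muT (d : ℕ) : Measure (Fin d → ℝ) :=
  volume.restrict (Set.Icc (fun _ => -(1 / 2 : ℝ)) (fun _ => (1 / 2 : ℝ)))

noncomputable def phi (d : ℕ) (ξ : Fin d → ℝ) : ℝ := (1 / d) * ∑ k, Real.cos (2 * Real.pi * ξ k)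

lemma phi_abs {d : ℕ} (hd : 0 < d) (ξ : Fin d → ℝ) : |phi d ξ| ≤ 1 := by
  have hd' : (0 : ℝ) < d := by exact_mod_cast hd
  rw [phi, abs_mul, abs_of_pos (by positivity : (0 : ℝ) < 1 / d), one_div, inv_mul_le_iff₀ hd', mul_one]
  refine (Finset.abs_sum_le_sum_abs _ _).trans ?_
  refine (Finset.sum_le_sum fun k _ => Real.abs_cos_le_one _).trans ?_
  simp

lemma sinNorm_eq {d : ℕ} (hd : 0 < d) (ξ : Fin d → ℝ) :
    sinNorm d ξ = Real.sqrt (d / 2) * Real.sqrt (1 - phi d ξ) := by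
  have hd' : (0 : ℝ) < d := by exact_mod_cast hd
  rw [sinNorm, ← Real.sqrt_mul (by positivity)]
  congr 1
  have : ∀ k, Real.sin (Real.pi * ξ k) ^ 2 = 1 / 2 - Real.cos (2 * Real.pi * ξ k) / 2 := fun k => by
    rw [Real.sin_sq_eq_half_sub]; ring_nf
  simp_rw [this]
  rw [Finset.sum_sub_distrib, phi]
  simp only [Finset.sum_const, Finset.card_univ, Fintype.card_fin, nsmul_eq_mul]
  rw [← Finset.sum_div]
  generalize ∑ k, Real.cos (2 * Real.pi * ξ k) = S
  field_simp

lemma ch_norm {d : ℕ} (z : Fin d → ℤ) (ξ : Fin d → ℝ) : ‖ch z ξ‖ = 1 := by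
  have : (-(2 * Real.pi * Complex.I) * ∑ k, ((z k : ℤ) : ℂ) * (ξ k : ℂ))
      = ((-(2 * Real.pi) * ∑ k, (z k : ℝ) * ξ k : ℝ) : ℂ) * Complex.I := by
    push_cast; ring
  rw [ch, this, Complex.norm_exp_ofReal_mul_I]

lemma ch_cont {d : ℕ} (z : Fin d → ℤ) : Continuous (ch z) := by
  unfold ch; fun_prop

lemma phi_cont (d : ℕ) : Continuous (phi d) := by
  unfold phi; fun_prop

instance (d : ℕ) : IsFiniteMeasure (muT d) := by
  unfold muT
  exact ⟨by rw [Measure.restrict_apply_univ]; exact isCompact_Icc.measure_lt_top⟩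

lemma ch_add_sub {d : ℕ} (z : Fin d → ℤ) (k : Fin d) (ξ : Fin d → ℝ) :
    ch (z + Pi.single k 1) ξ + ch (z - Pi.single k 1) ξ
      = 2 * (Real.cos (2 * Real.pi * ξ k) : ℂ) * ch z ξ := by
  have hs : ∑ j, (((Pi.single k 1 : Fin d → ℤ) j : ℤ) : ℂ) * (ξ j : ℂ) = ξ k := by
    rw [Finset.sum_eq_single k]
    · simp
    · intro j _ hj; simp [Pi.single_eq_of_ne hj]
    · simp
  have h1 : ch (z + Pi.single k 1) ξ = ch z ξ * Complex.exp (-(2 * Real.pi * ξ k) * Complex.I) := by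
    simp only [ch, Pi.add_apply, Int.cast_add, add_mul, Finset.sum_add_distrib, hs]
    rw [← Complex.exp_add]; ring_nf
  have h2 : ch (z - Pi.single k 1) ξ = ch z ξ * Complex.exp ((2 * Real.pi * ξ k) * Complex.I) := by
    simp only [ch, Pi.sub_apply, Int.cast_sub, sub_mul, Finset.sum_sub_distrib, hs]
    rw [← Complex.exp_add]; ring_nf
  rw [h1, h2, Complex.ofReal_cos, Complex.two_cos]
  push_cast
  ring

lemma int_base {d : ℕ} (z : Fin d → ℤ) : ∫ ξ, ch z ξ ∂(muT d) = if z = 0 then 1 else 0 := by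
  have h1 : ∀ ξ, ch z ξ = ∏ k, Complex.exp (-(2 * Real.pi * Complex.I) * (z k) * (ξ k : ℂ)) := by
    intro ξ
    rw [ch, ← Complex.exp_sum, Finset.mul_sum]
    simp_rw [mul_assoc]
  have h2 : muT d = Measure.pi (fun _ : Fin d => (volume : Measure ℝ).restrict (Set.Icc (-(1/2)) (1/2))) := by
    rw [muT, ← Set.pi_univ_Icc, volume_pi, Measure.restrict_pi_pi]
  simp_rw [h1]
  rw [h2, integral_fintype_prod_eq_prod (𝕜 := ℂ)
    (fun (k : Fin d) (t : ℝ) => Complex.exp (-(2 * Real.pi * Complex.I) * (z k) * (t : ℂ)))]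
  have h3 : ∀ n : ℤ, ∫ t in Set.Icc (-(1/2) : ℝ) (1/2), Complex.exp (-(2 * Real.pi * Complex.I) * n * (t : ℂ))
      = if n = 0 then 1 else 0 := by
    intro n
    rw [integral_Icc_eq_integral_Ioc, ← intervalIntegral.integral_of_le (by norm_num)]
    split_ifs with hn
    · subst hn; simp; norm_num
    · have hc : -(2 * Real.pi * Complex.I) * (n : ℂ) ≠ 0 := by
        simp [hn, Real.pi_ne_zero]
      rw [integral_exp_mul_complex hc]
      have : Complex.exp (-(2 * Real.pi * Complex.I) * n * ((-(1/2) : ℝ) : ℂ))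
          = Complex.exp (-(2 * Real.pi * Complex.I) * n * ((1/2 : ℝ) : ℂ)) := by
        rw [Complex.exp_eq_exp_iff_exists_int]
        exact ⟨n, by push_cast; ring⟩
      rw [this]; simp
  simp_rw [h3]
  split_ifs with hz
  · subst hz; simp
  · obtain ⟨k, hk⟩ : ∃ k, z k ≠ 0 := by
      by_contra! h; exact hz (funext h)
    exact Finset.prod_eq_zero (Finset.mem_univ k) (by simp [hk])

lemma int_aux {d : ℕ} (hd : 0 < d) (n : ℕ) (z : Fin d → ℤ) :
    Integrable (fun ξ => ((phi d ξ : ℂ)) ^ n * ch z ξ) (muT d) := by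
  refine Integrable.of_bound (C := 1) ?_ ?_
  · apply Continuous.aestronglyMeasurable
    have := phi_cont d
    have := ch_cont z
    fun_prop
  · refine Filter.Eventually.of_forall fun ξ => ?_
    rw [norm_mul, ch_norm, mul_one, norm_pow, Complex.norm_real]
    exact pow_le_one₀ (norm_nonneg _) (phi_abs hd ξ)

lemma int_succ {d : ℕ} (hd : 0 < d) (n : ℕ) (x y : Fin d → ℤ) :
    ∫ ξ, ((phi d ξ : ℂ)) ^ (n + 1) * ch (x - y) ξ ∂(muT d) = (1 / (2 * d) : ℂ) *
      ∑ k : Fin d, ((∫ ξ, ((phi d ξ : ℂ)) ^ n * ch (x + Pi.single k 1 - y) ξ ∂(muT d))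
        + ∫ ξ, ((phi d ξ : ℂ)) ^ n * ch (x - Pi.single k 1 - y) ξ ∂(muT d)) := by
  have hdc : (d : ℂ) ≠ 0 := by exact_mod_cast hd.ne'
  have h1 : ∀ k : Fin d, (∫ ξ, ((phi d ξ : ℂ)) ^ n * ch (x + Pi.single k 1 - y) ξ ∂(muT d))
        + ∫ ξ, ((phi d ξ : ℂ)) ^ n * ch (x - Pi.single k 1 - y) ξ ∂(muT d)
      = ∫ ξ, (((phi d ξ : ℂ)) ^ n * ch (x + Pi.single k 1 - y) ξ
        + ((phi d ξ : ℂ)) ^ n * ch (x - Pi.single k 1 - y) ξ) ∂(muT d) := fun k =>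
    (integral_add (int_aux hd n _) (int_aux hd n _)).symm
  have hint : ∀ k : Fin d, Integrable (fun ξ => ((phi d ξ : ℂ)) ^ n * ch (x + Pi.single k 1 - y) ξ
        + ((phi d ξ : ℂ)) ^ n * ch (x - Pi.single k 1 - y) ξ) (muT d) := fun k =>
    (int_aux hd n (x + Pi.single k 1 - y)).add (int_aux hd n (x - Pi.single k 1 - y))
  simp_rw [h1]
  rw [← integral_finsetSum Finset.univ (fun k _ => hint k), ← integral_const_mul]
  congr 1; ext ξ
  have h : ∀ k, (phi d ξ : ℂ) ^ n * ch (x + Pi.single k 1 - y) ξ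
      + (phi d ξ : ℂ) ^ n * ch (x - Pi.single k 1 - y) ξ
      = (phi d ξ : ℂ) ^ n * ch (x - y) ξ * 2 * (Real.cos (2 * Real.pi * ξ k) : ℂ) := fun k => by
    rw [add_sub_right_comm, sub_right_comm, ← mul_add, ch_add_sub]; ring
  simp_rw [h]
  rw [← Finset.mul_sum, pow_succ]
  have h3 : ∑ k, (Real.cos (2 * Real.pi * ξ k) : ℂ) = d * (phi d ξ : ℂ) := by
    simp [phi, hdc]
  rw [h3]
  field_simp

lemma PP_pow_single {d : ℕ} (hd : 0 < d) {p : ℝ≥0∞} [Fact (1 ≤ p)] (hp : 0 < p.toReal) (n : ℕ)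
    (y x : Fin d → ℤ) : ((PP hp) ^ n) (lp.single p y (1 : ℂ) : EE d p) x
      = ∫ ξ, ((phi d ξ : ℂ)) ^ n * ch (x - y) ξ ∂(muT d) := by
  induction n generalizing x with
  | zero =>
    simp only [pow_zero, one_mul, int_base, sub_eq_zero]
    simp [lp.single_apply, Pi.single_apply]
  | succ n ih =>
    have h0 : ((PP hp) ^ (n + 1)) (lp.single p y (1 : ℂ) : EE d p)
        = PP hp (((PP hp) ^ n) (lp.single p y (1 : ℂ) : EE d p)) := by
      rw [pow_succ']; rfl
    rw [h0, PP_apply]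
    simp_rw [ih]
    exact (int_succ hd n x y).symm

lemma kernel_hasSum {d : ℕ} (hd : 0 < d) (z : Fin d → ℤ) :
    HasSum (fun n => (cc n : ℂ) * ((∫ ξ, ch z ξ ∂(muT d)) - ∫ ξ, ((phi d ξ : ℂ)) ^ (n + 1) * ch z ξ ∂(muT d)))
      (∫ ξ, (Real.sqrt (1 - phi d ξ) : ℂ) * ch z ξ ∂(muT d)) := by
  have h0 : ∀ n, (cc n : ℂ) * ((∫ ξ, ch z ξ ∂(muT d)) - ∫ ξ, ((phi d ξ : ℂ)) ^ (n + 1) * ch z ξ ∂(muT d))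
      = ∫ ξ, (cc n : ℂ) * ((1 - (phi d ξ : ℂ) ^ (n + 1)) * ch z ξ) ∂(muT d) := fun n => by
    have h1 : Integrable (ch z) (muT d) := by simpa using int_aux hd 0 z
    rw [← integral_sub h1 (int_aux hd _ z), ← integral_const_mul]
    congr 1; ext ξ; ring
  simp_rw [h0]
  refine hasSum_integral_of_dominated_convergence (fun n _ => cc n * 2) ?_ ?_ ?_ ?_ ?_
  · intro n
    apply Continuous.aestronglyMeasurable
    have := phi_cont d
    have := ch_cont z
    fun_prop
  · intro n
    refine Filter.Eventually.of_forall fun ξ => ?_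
    rw [norm_mul, norm_mul, ch_norm, mul_one, Complex.norm_real, Real.norm_of_nonneg (cc_nonneg n)]
    refine mul_le_mul_of_nonneg_left ?_ (cc_nonneg n)
    refine (norm_sub_le _ _).trans ?_
    rw [norm_pow, Complex.norm_real, norm_one]
    have := pow_le_one₀ (n := n + 1) (abs_nonneg _) (phi_abs hd ξ)
    rw [Real.norm_eq_abs]
    linarith
  · exact Filter.Eventually.of_forall fun ξ => hasSum_cc.summable.mul_right 2
  · exact integrable_const _
  · refine Filter.Eventually.of_forall fun ξ => ?_
    have h1 := hasSum_cc.sub (hasSum_sqrt _ (phi_abs hd ξ))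
    have h2 : HasSum (fun n => (((cc n - cc n * phi d ξ ^ (n + 1) : ℝ)) : ℂ)) (Real.sqrt (1 - phi d ξ) : ℂ) := by
      rw [Complex.hasSum_ofReal]
      simpa using h1
    refine (h2.mul_right (ch z ξ)).congr_fun ?_
    intro n
    push_cast; ring

lemma lpZfin_eq {d : ℕ} {q : ℝ} (hq : 1 ≤ q) (f : EE d (ENNReal.ofReal q)) :
    lpZfin d q (fun x => (‖f x‖₊ : ℝ≥0∞)) = ENNReal.ofReal ‖f‖ := by
  have hq0 : 0 < q := by linarith
  have hp : (ENNReal.ofReal q).toReal = q := ENNReal.toReal_ofReal hq0.le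
  have hp' : 0 < (ENNReal.ofReal q).toReal := by rw [hp]; exact hq0
  have hs := (memℓp_gen_iff hp').1 (lp.memℓp f)
  rw [lp.norm_eq_tsum_rpow hp', lpZfin]
  rw [hp] at *
  rw [← ENNReal.ofReal_rpow_of_nonneg (tsum_nonneg fun i => by positivity) (by positivity),
    ENNReal.ofReal_tsum_of_nonneg (fun i => by positivity) hs]
  congr 2; ext x
  rw [← ENNReal.ofReal_rpow_of_nonneg (norm_nonneg _) hq0.le, ofReal_norm]; rfl

lemma mem_of_lpZfin {d : ℕ} {q : ℝ} (hq : 1 ≤ q) (f : (Fin d → ℤ) → ℂ)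
    (hf : lpZfin d q (fun x => (‖f x‖₊ : ℝ≥0∞)) ≠ ∞) : Memℓp f (ENNReal.ofReal q) := by
  have hq0 : 0 < q := by linarith
  have hp : (ENNReal.ofReal q).toReal = q := ENNReal.toReal_ofReal hq0.le
  have hp' : 0 < (ENNReal.ofReal q).toReal := by rw [hp]; exact hq0
  rw [memℓp_gen_iff hp', hp]
  have h1 : ∑' x, (‖f x‖₊ : ℝ≥0∞) ^ q ≠ ∞ := by
    intro h; apply hf; rw [lpZfin, h]; exact ENNReal.top_rpow_of_pos (by positivity)
  have := ENNReal.summable_toReal h1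
  refine this.congr fun x => ?_
  rw [← ENNReal.toReal_rpow]; simp

/-- the square-root interpolation inequality (A.5):
`‖𝓛^{1/2} f‖_q ≤ 2 ‖𝓛 f‖_q^{1/2} ‖f‖_q^{1/2}` on ℓ^q(ℤ^d), `q ∈ [1,∞)`. -/
theorem statement19 (q : ℝ) (hq : 1 ≤ q) (d : ℕ) (f : (Fin d → ℤ) → ℂ)
    (hf : lpZfin d q (fun x => (‖f x‖₊ : ℝ≥0∞)) ≠ ∞) :
    lpZfin d q (fun x => (‖discLapSqrt d f x‖₊ : ℝ≥0∞))
      ≤ 2 * (lpZfin d q (fun x => (‖discLap d f x‖₊ : ℝ≥0∞))) ^ (1 / 2 : ℝ)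
          * (lpZfin d q (fun x => (‖f x‖₊ : ℝ≥0∞))) ^ (1 / 2 : ℝ) := by
  have hq0 : 0 < q := by linarith
  rcases Nat.eq_zero_or_pos d with rfl | hd
  · have : ∀ x, discLapSqrt 0 f x = 0 := fun x => by simp [discLapSqrt, fmOp, sinNorm]
    simp [this, lpZfin, hq0]
  have hfact : Fact (1 ≤ ENNReal.ofReal q) := ⟨by simpa using hq⟩
  have hp' : 0 < (ENNReal.ofReal q).toReal := by rw [ENNReal.toReal_ofReal hq0.le]; exact hq0
  obtain ⟨F, rfl⟩ : ∃ F : EE d (ENNReal.ofReal q), ⇑F = f := ⟨⟨f, mem_of_lpZfin hq f hf⟩, rfl⟩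
  obtain ⟨T, hT, hb⟩ := op_bound (PP hp') (PP_norm hd hp') F
  have hd' : (0 : ℝ) < d := by exact_mod_cast hd
  have hdc : (d : ℂ) ≠ 0 := by exact_mod_cast hd.ne'
  have hL : discLap d F = ⇑((d / 2 : ℂ) • (F - PP hp' F)) := by
    ext x
    simp only [lp.coeFn_smul, lp.coeFn_sub, Pi.smul_apply, Pi.sub_apply, PP_apply, discLap, smul_eq_mul]
    simp only [sub_sub, Finset.sum_sub_distrib, Finset.sum_const, Finset.card_univ,
      Fintype.card_fin, nsmul_eq_mul]
    field_simp
    ring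
  have hker : ∀ x y, (T (lp.single (ENNReal.ofReal q) y (1 : ℂ)) : EE d (ENNReal.ofReal q)) x
      = ∫ ξ, (Real.sqrt (1 - phi d ξ) : ℂ) * ch (x - y) ξ ∂(muT d) := by
    intro x y
    have h1 := (lp.evalCLM ℂ (fun _ : Fin d → ℤ => ℂ) (ENNReal.ofReal q) x).hasSum
      (hT (lp.single (ENNReal.ofReal q) y (1 : ℂ)))
    refine h1.unique ?_
    refine (kernel_hasSum hd (x - y)).congr_fun fun n => ?_
    have h2 := PP_pow_single hd hp' 0 y x
    simp only [pow_zero, one_mul, one_apply_eq_self] at h2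
    rw [← PP_pow_single hd hp', ← h2]
    rfl
  have hS : discLapSqrt d F = ⇑((Real.sqrt (d / 2) : ℂ) • T F) := by
    ext x
    have h1 := (lp.evalCLM ℂ (fun _ : Fin d → ℤ => ℂ) (ENNReal.ofReal q) x).hasSum
      (T.hasSum (lp.hasSum_single (by simp) F))
    have h2 := (h1.mul_left (Real.sqrt (d / 2) : ℂ)).tsum_eq
    refine Eq.trans ?_ h2
    rw [discLapSqrt, fmOp]
    congr 1; ext y
    have h3 : (lp.single (ENNReal.ofReal q) y (F y) : EE d (ENNReal.ofReal q))
        = F y • lp.single (ENNReal.ofReal q) y (1 : ℂ) := by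
      rw [← lp.single_smul]; simp
    have h4 : (lp.evalCLM ℂ (fun _ : Fin d → ℤ => ℂ) (ENNReal.ofReal q) x)
        (T (lp.single (ENNReal.ofReal q) y (F y)))
        = F y * ∫ ξ, (Real.sqrt (1 - phi d ξ) : ℂ) * ch (x - y) ξ ∂(muT d) := by
      rw [h3, map_smul, map_smul, ← hker]; rfl
    rw [h4, mul_left_comm, ← integral_const_mul, mul_comm]
    congr 1
    rw [muT]
    congr 1; ext ξ
    rw [sinNorm_eq hd, ch]
    push_cast; ring
  rw [hL, hS, lpZfin_eq hq, lpZfin_eq hq, lpZfin_eq hq, norm_smul, norm_smul,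
    ENNReal.ofReal_rpow_of_nonneg (by positivity) (by norm_num),
    ENNReal.ofReal_rpow_of_nonneg (by positivity) (by norm_num),
    show (2 : ℝ≥0∞) = ENNReal.ofReal 2 by simp, ← ENNReal.ofReal_mul (by norm_num),
    ← ENNReal.ofReal_mul (by positivity)]
  apply ENNReal.ofReal_le_ofReal
  rw [← Real.sqrt_eq_rpow, ← Real.sqrt_eq_rpow, Complex.norm_real,
    Real.norm_of_nonneg (Real.sqrt_nonneg _)]
  have h5 : ‖(d / 2 : ℂ)‖ = d / 2 := by simp
  rw [h5, Real.sqrt_mul (by positivity)]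
  rw [Real.sqrt_mul (by positivity)] at hb
  nlinarith [mul_le_mul_of_nonneg_left hb (Real.sqrt_nonneg ((d : ℝ) / 2))]
end
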